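/- arXiv:1111.6766 — 2 statements merged into one kernel-verified Lean document; each statement's English description precedes it below -/
import Mathlib

section
/- The proportion of unlabelled n-element interval orders that are rigid tends to e^{-π²/6} as n → ∞; that is, r_n / i_n → e^{-π²/6}. -/
open scoped Classical

/-- An interval order on `Fin n`: a strict partial order with no induced `2+2`. -/
def IntervalOrderRel (n : ℕ) : Type :=
  {r : Fin n → Fin n → Prop // IsStrictOrder (Fin n) r ∧
    ∀ a b c d, r a b → r c d → r a d ∨ r c b}

/-- Two interval orders on `Fin n` are isomorphic if some permutation of the
ground set transforms one into the other. -/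
def IntervalOrderIso {n : ℕ} (P Q : IntervalOrderRel n) : Prop :=
  ∃ e : Equiv.Perm (Fin n), ∀ a b, P.1 a b ↔ Q.1 (e a) (e b)

/-- `i n`: the number of unlabelled interval orders on `n` points, i.e. the number
of isomorphism classes of interval orders on an `n`-element set. -/
noncomputable def intervalOrderCount (n : ℕ) : ℕ :=
  Nat.card (Quot (IntervalOrderIso (n := n)))

/-- A poset is rigid if its only (order) automorphism is the identity. -/
def IsRigid {n : ℕ} (P : IntervalOrderRel n) : Prop :=
  ∀ e : Equiv.Perm (Fin n), (∀ a b, P.1 a b ↔ P.1 (e a) (e b)) → e = 1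

/-- `r n`: the number of unlabelled rigid interval orders on `n` points. -/
noncomputable def rigidIntervalOrderCount (n : ℕ) : ℕ :=
  Nat.card (Quot fun (P Q : {P : IntervalOrderRel n // IsRigid P}) =>
    IntervalOrderIso P.1 Q.1)

/-- `ℓ n`: the number of labelled interval orders on an `n`-element set. -/
noncomputable def labelledIntervalOrderCount (n : ℕ) : ℕ :=
  Nat.card (IntervalOrderRel n)

/-- `x` and `y` are distinct elements with duplicated holdings:
`D(x) = D(y)` and `U(x) = U(y)`. -/
def DupHoldings {n : ℕ} (P : IntervalOrderRel n) (x y : Fin n) : Prop :=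
  x ≠ y ∧ (∀ z, P.1 z x ↔ P.1 z y) ∧ (∀ z, P.1 x z ↔ P.1 y z)

/-- The number of unordered pairs `{x, y}` of distinct elements with duplicated
holdings. -/
noncomputable def dupPairCount {n : ℕ} (P : IntervalOrderRel n) : ℕ :=
  Nat.card {s : Finset (Fin n) // ∃ x y, DupHoldings P x y ∧ s = {x, y}}

/-- `P` has three distinct elements pairwise having duplicated holdings. -/
def HasDupTriple {n : ℕ} (P : IntervalOrderRel n) : Prop :=
  ∃ x y z : Fin n, x ≠ y ∧ x ≠ z ∧ y ≠ z ∧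
    DupHoldings P x y ∧ DupHoldings P x z ∧ DupHoldings P y z

/-- The Stirling number of the second kind `S(n, k)`: the number of partitions
of an `n`-element set into `k` non-empty parts. -/
noncomputable def stirling2 (n k : ℕ) : ℕ :=
  Nat.card {P : Finpartition (Finset.univ : Finset (Fin n)) // P.parts.card = k}

section ThetaIdentity

open Polynomial

/-- A telescoping form of the functional equation of the partial theta series
`∑ (x; q)_{n+1} x ^ n`. -/
theorem sum_qPochhammer_functional_equation {R : Type*} [CommRing R] (x q : R) (N : ℕ) :
    ∑ n ∈ Finset.range N, (∏ j ∈ Finset.range (n + 1), (1 - x * q ^ j)) * x ^ n +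
        q ^ 2 * x ^ 3 * ∑ n ∈ Finset.range N,
          (∏ j ∈ Finset.range (n + 1), (1 - x * q * q ^ j)) * (x * q) ^ n =
      1 - q * x ^ 2 -
        x ^ N * (∏ j ∈ Finset.range N, (1 - x * q * q ^ j)) * (1 - x ^ 2 * q ^ (N + 1)) := by
  induction N with
  | zero => simp; ring
  | succ N ih =>
    have h : ∏ j ∈ Finset.range (N + 1), (1 - x * q ^ j) =
        (∏ j ∈ Finset.range N, (1 - x * q * q ^ j)) * (1 - x) := by
      rw [Finset.prod_range_succ']
      congr 1
      · exact Finset.prod_congr rfl fun j _ => by ring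
      · simp
    rw [Finset.sum_range_succ, Finset.sum_range_succ, h]
    rw [Finset.prod_range_succ (fun j => 1 - x * q * q ^ j) N]
    linear_combination ih

/-- A polynomial solution `P` of `P(c) + P(c + 1) = 0` vanishes. -/
theorem eq_zero_of_add_comp_eq_zero {P : ℚ[X]} (h : P + P.comp (X + 1) = 0) : P = 0 := by
  have h1 : (P.comp (X + 1)).leadingCoeff = P.leadingCoeff := by
    rw [leadingCoeff_comp]
    · have : (X + 1 : ℚ[X]).leadingCoeff = 1 := by
        simpa using leadingCoeff_X_add_C (1 : ℚ)
      rw [this]; simp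
    · have : (X + 1 : ℚ[X]).natDegree = 1 := by
        simpa using natDegree_X_add_C (1 : ℚ)
      rw [this]; simp
  rw [add_eq_zero_iff_neg_eq.1 h |>.symm, leadingCoeff_neg] at h1
  have : P.leadingCoeff = 0 := by linarith
  simpa using this

/-- The exponential series `exp (-p t)` in the variable `t`. -/
noncomputable def expNeg {A : Type*} [CommRing A] [Algebra ℚ A] (p : A) : PowerSeries A :=
  PowerSeries.rescale (-p) (PowerSeries.exp A)

section expNeg

variable {A B : Type*} [CommRing A] [Algebra ℚ A] [CommRing B] [Algebra ℚ B]

theorem expNeg_add (p r : A) : expNeg (p + r) = expNeg p * expNeg r := by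
  rw [expNeg, expNeg, expNeg, PowerSeries.exp_mul_exp_eq_exp_add, neg_add]

theorem expNeg_zero : expNeg (0 : A) = 1 := by
  simp [expNeg]

theorem expNeg_natCast_mul (p : A) (k : ℕ) : expNeg (k * p) = expNeg p ^ k := by
  induction k with
  | zero => simp [expNeg_zero]
  | succ k ih => rw [pow_succ, ← ih, ← expNeg_add]; push_cast; ring_nf

theorem coeff_expNeg (p : A) (k : ℕ) :
    PowerSeries.coeff k (expNeg p) = (-p) ^ k * algebraMap ℚ A (1 / k.factorial) := by
  rw [expNeg, PowerSeries.coeff_rescale, PowerSeries.coeff_exp]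

theorem map_expNeg (f : A →+* B) (p : A) :
    PowerSeries.map f (expNeg p) = expNeg (f p) := by
  ext k
  rw [PowerSeries.coeff_map, coeff_expNeg, coeff_expNeg, map_mul, map_pow, map_neg]
  congr 1
  exact congrArg (fun g : ℚ →+* B => g (1 / (k.factorial : ℚ)))
    (RingHom.ext_rat (f.comp (algebraMap ℚ A)) (algebraMap ℚ B))

theorem X_dvd_one_sub_expNeg (p : A) : PowerSeries.X ∣ 1 - expNeg p := by
  rw [PowerSeries.X_dvd_iff]
  rw [← PowerSeries.coeff_zero_eq_constantCoeff_apply, map_sub, coeff_expNeg]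
  simp

end expNeg

/-- The truncated Fishburn series `∑_{m < N} ∏_{1 ≤ j ≤ m} (1 - q ^ j)`. -/
noncomputable def fishburnSum {R : Type*} [CommRing R] (N : ℕ) (q : R) : R :=
  ∑ m ∈ Finset.range N, ∏ j ∈ Finset.range m, (1 - q ^ (j + 1))

/-- The truncated partial theta series `∑_{n < N} (q ^ c; q)_{n + 1} q ^ (c n)`, normalised by
`q ^ ((6 c + 1) ^ 2 / 24)`, where `q = exp (-t)` and `c` is the polynomial variable. -/
noncomputable def thetaSum (N : ℕ) : PowerSeries ℚ[X] :=
  expNeg (C (1 / 24) * (6 * X + 1) ^ 2) *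
    ∑ n ∈ Finset.range N,
      (∏ j ∈ Finset.range (n + 1), (1 - expNeg X * expNeg (1 : ℚ[X]) ^ j)) * expNeg X ^ n

theorem X_pow_dvd_thetaSum_add (N : ℕ) :
    PowerSeries.X ^ N ∣ thetaSum N + PowerSeries.map (compRingHom (X + 1)) (thetaSum N) -
      (expNeg (C (1 / 24) * (6 * X + 1) ^ 2) - expNeg (C (1 / 24) * (6 * X + 5) ^ 2)) := by
  have hq : (compRingHom (X + 1) : ℚ[X] →+* ℚ[X]) 1 = 1 := map_one _
  have hx : (compRingHom (X + 1) : ℚ[X] →+* ℚ[X]) X = X + 1 := by simp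
  have hc : (compRingHom (X + 1) : ℚ[X] →+* ℚ[X]) (C (1 / 24) * (6 * X + 1) ^ 2) =
      C (1 / 24) * (6 * X + 1) ^ 2 + (((2 : ℕ) : ℚ[X]) * 1 + ((3 : ℕ) : ℚ[X]) * X) := by
    have : (C (1 / 24) : ℚ[X]) * 24 = 1 := by
      rw [show (24 : ℚ[X]) = C 24 from rfl, ← C_mul]; norm_num
    simp only [coe_compRingHom, mul_comp, C_comp, pow_comp, add_comp, X_comp, one_comp,
      ofNat_comp]
    push_cast
    linear_combination (2 + 3 * X) * this
  have hd : (C (1 / 24) * (6 * X + 5) ^ 2 : ℚ[X]) =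
      C (1 / 24) * (6 * X + 1) ^ 2 + (1 + ((2 : ℕ) : ℚ[X]) * X) := by
    have : (C (1 / 24) : ℚ[X]) * 24 = 1 := by
      rw [show (24 : ℚ[X]) = C 24 from rfl, ← C_mul]; norm_num
    push_cast
    linear_combination (1 + 2 * X) * this
  have key := sum_qPochhammer_functional_equation (expNeg X) (expNeg (1 : ℚ[X])) N
  have hdvd : PowerSeries.X ^ N ∣
      ∏ j ∈ Finset.range N, (1 - expNeg X * expNeg (1 : ℚ[X]) * expNeg (1 : ℚ[X]) ^ j) := by
    have h := Finset.prod_dvd_prod_of_dvd (s := Finset.range N) (fun _ => PowerSeries.X)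
      (fun j => 1 - expNeg X * expNeg (1 : ℚ[X]) * expNeg (1 : ℚ[X]) ^ j) (fun j _ => by
        rw [← expNeg_natCast_mul, ← expNeg_add, ← expNeg_add]
        exact X_dvd_one_sub_expNeg _)
    simpa using h
  refine (hdvd.mul_left (-(expNeg (C (1 / 24) * (6 * X + 1) ^ 2) * expNeg X ^ N *
    (1 - expNeg X ^ 2 * expNeg (1 : ℚ[X]) ^ (N + 1))))).trans (dvd_of_eq ?_)
  rw [thetaSum]
  simp only [map_mul, map_sum, map_prod, map_sub, map_one, map_pow, map_expNeg, hq, hx, hc, hd]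
  simp only [expNeg_add _ _, expNeg_natCast_mul]
  linear_combination (-expNeg (C (1 / 24) * (6 * X + 1) ^ 2)) * key

/-- The coefficient of `t ^ k` in the theta series, through Bernoulli polynomials. -/
noncomputable def thetaPoly (k : ℕ) : ℚ[X] :=
  C ((-6 : ℚ) ^ k / (k.factorial * (2 * k + 1))) *
    ((Polynomial.bernoulli (2 * k + 1)).comp (C (1 / 2) * X + C (7 / 12)) -
      (Polynomial.bernoulli (2 * k + 1)).comp (C (1 / 2) * X + C (1 / 12)) -
      (Polynomial.bernoulli (2 * k + 1)).comp (C (1 / 2) * X + C (11 / 12)) +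
      (Polynomial.bernoulli (2 * k + 1)).comp (C (1 / 2) * X + C (5 / 12)))

theorem bernoulli_comp_one_add (n : ℕ) (p : ℚ[X]) :
    (Polynomial.bernoulli n).comp (1 + p) =
      (Polynomial.bernoulli n).comp p + C (n : ℚ) * p ^ (n - 1) := by
  have := congrArg (fun r : ℚ[X] => r.comp p) (bernoulli_comp_one_add_X n)
  simpa only [comp_assoc, add_comp, one_comp, X_comp, smul_comp, pow_comp, nsmul_eq_mul,
    natCast_comp, mul_comp, map_natCast] using this

theorem thetaPoly_add_comp (k : ℕ) :
    thetaPoly k + (thetaPoly k).comp (X + 1) =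
      PowerSeries.coeff k (expNeg (C (1 / 24) * (6 * X + 1) ^ 2) -
        expNeg (C (1 / 24) * (6 * X + 5) ^ 2)) := by
  have e1 : (C (1 / 2) * (X + 1) + C (7 / 12) : ℚ[X]) = 1 + (C (1 / 2) * X + C (1 / 12)) := by
    rw [show (7 / 12 : ℚ) = 1 - 1 / 2 + 1 / 12 by norm_num]
    simp only [map_add, map_sub, map_one]; ring
  have e2 : (C (1 / 2) * (X + 1) + C (1 / 12) : ℚ[X]) = C (1 / 2) * X + C (7 / 12) := by
    rw [show (7 / 12 : ℚ) = 1 / 2 + 1 / 12 by norm_num]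
    simp only [map_add]; ring
  have e3 : (C (1 / 2) * (X + 1) + C (11 / 12) : ℚ[X]) = 1 + (C (1 / 2) * X + C (5 / 12)) := by
    rw [show (11 / 12 : ℚ) = 1 - 1 / 2 + 5 / 12 by norm_num]
    simp only [map_add, map_sub, map_one]; ring
  have e4 : (C (1 / 2) * (X + 1) + C (5 / 12) : ℚ[X]) = C (1 / 2) * X + C (11 / 12) := by
    rw [show (11 / 12 : ℚ) = 1 / 2 + 5 / 12 by norm_num]
    simp only [map_add]; ring
  have f1 : (C (1 / 24) * (6 * X + 1) ^ 2 : ℚ[X]) =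
      C 6 * (C (1 / 2) * X + C (1 / 12)) ^ 2 := by
    refine Polynomial.funext fun r => ?_
    simp; ring
  have f2 : (C (1 / 24) * (6 * X + 5) ^ 2 : ℚ[X]) =
      C 6 * (C (1 / 2) * X + C (5 / 12)) ^ 2 := by
    refine Polynomial.funext fun r => ?_
    simp; ring
  rw [map_sub, coeff_expNeg, coeff_expNeg, f1, f2, thetaPoly]
  simp only [mul_comp, C_comp, sub_comp, add_comp, comp_assoc, X_comp, e1, e2, e3, e4,
    bernoulli_comp_one_add]
  refine Polynomial.funext fun r => ?_
  have hk : (2 * (k : ℚ) + 1) ≠ 0 := by positivity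
  have hf : (k.factorial : ℚ) ≠ 0 := by positivity
  simp only [eval_add, eval_mul, eval_sub, eval_C, eval_pow, eval_X, eval_neg, eval_comp,
    algebraMap_eq, Nat.add_sub_cancel, ← neg_mul, mul_pow, ← pow_mul]
  generalize (1 / 2 * r + 1 / 12) ^ (2 * k) = y
  generalize (1 / 2 * r + 5 / 12) ^ (2 * k) = z
  push_cast
  field_simp
  ring

theorem coeff_thetaSum {k N : ℕ} (h : k < N) :
    PowerSeries.coeff k (thetaSum N) = thetaPoly k := by
  have h1 := PowerSeries.X_pow_dvd_iff.1 (X_pow_dvd_thetaSum_add N) k h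
  rw [map_sub, ← thetaPoly_add_comp, map_add, PowerSeries.coeff_map] at h1
  refine sub_eq_zero.1 (eq_zero_of_add_comp_eq_zero ?_)
  rw [sub_comp]
  simp only [coe_compRingHom] at h1
  linear_combination h1

/-- The series `(1 - exp (-c t)) / c`. -/
noncomputable def oneSubExpDiv : PowerSeries ℚ[X] :=
  PowerSeries.mk fun k => C (-(-1) ^ k / (k.factorial : ℚ)) * if k = 0 then 0 else X ^ (k - 1)

theorem C_X_mul_oneSubExpDiv :
    PowerSeries.C (X : ℚ[X]) * oneSubExpDiv = 1 - expNeg X := by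
  ext1 k
  rw [PowerSeries.coeff_C_mul, oneSubExpDiv, PowerSeries.coeff_mk, map_sub, coeff_expNeg,
    PowerSeries.coeff_one, algebraMap_eq]
  rcases k with _ | k
  · simp
  · simp only [Nat.add_eq_zero_iff, one_ne_zero, and_false, if_false, Nat.add_sub_cancel, zero_sub]
    rw [neg_pow (X : ℚ[X]), pow_succ (X : ℚ[X]), div_eq_mul_one_div, C_mul, map_neg, map_pow,
      map_neg, map_one]
    ring

theorem map_eval_oneSubExpDiv :
    PowerSeries.map (evalRingHom (0 : ℚ)) oneSubExpDiv = PowerSeries.X := by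
  ext1 k
  rw [PowerSeries.coeff_map, oneSubExpDiv, PowerSeries.coeff_mk, PowerSeries.coeff_X]
  rcases k with _ | _ | k <;> simp

theorem derivative_thetaPoly_eval {k N : ℕ} (h : k + 1 < N) :
    (derivative (thetaPoly (k + 1))).eval 0 =
      PowerSeries.coeff k (expNeg (1 / 24 : ℚ) * fishburnSum N (expNeg 1)) := by
  set Y : PowerSeries ℚ[X] := expNeg (C (1 / 24) * (6 * X + 1) ^ 2) * (oneSubExpDiv *
    ∑ n ∈ Finset.range N,
      (∏ j ∈ Finset.range n, (1 - expNeg X * expNeg (1 : ℚ[X]) ^ (j + 1))) * expNeg X ^ n) with hY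
  have h1 : thetaSum N = PowerSeries.C (X : ℚ[X]) * Y := by
    rw [hY, thetaSum, mul_left_comm, ← mul_assoc (PowerSeries.C _), C_X_mul_oneSubExpDiv]
    refine congrArg (expNeg (C (1 / 24) * (6 * X + 1) ^ 2) * ·) ?_
    rw [Finset.mul_sum]
    refine Finset.sum_congr rfl fun n _ => ?_
    rw [Finset.prod_range_succ', pow_zero, mul_one]
    ring
  have h2 : PowerSeries.map (evalRingHom (0 : ℚ)) Y =
      (expNeg (1 / 24 : ℚ) * fishburnSum N (expNeg 1)) * PowerSeries.X := by
    simp only [hY, map_mul, map_sum, map_prod, map_sub, map_one, map_pow, map_expNeg,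
      map_eval_oneSubExpDiv, fishburnSum]
    simp [expNeg_zero]
    ring
  rw [← coeff_thetaSum h, h1, PowerSeries.coeff_C_mul, derivative_mul, derivative_X, eval_add,
    eval_mul, eval_mul, eval_X, eval_one, one_mul, zero_mul, add_zero,
    ← PowerSeries.coeff_succ_mul_X k (expNeg (1 / 24 : ℚ) * _), ← h2, PowerSeries.coeff_map,
    coe_evalRingHom]

theorem derivative_thetaPoly_eval_eq (k : ℕ) :
    (derivative (thetaPoly k)).eval 0 = (-6) ^ k / k.factorial / 2 *
      ((Polynomial.bernoulli (2 * k)).eval (7 / 12) - (Polynomial.bernoulli (2 * k)).eval (1 / 12) -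
        (Polynomial.bernoulli (2 * k)).eval (11 / 12) +
        (Polynomial.bernoulli (2 * k)).eval (5 / 12)) := by
  have hk : (2 * (k : ℚ) + 1) ≠ 0 := by positivity
  have hf : (k.factorial : ℚ) ≠ 0 := by positivity
  simp only [thetaPoly, derivative_mul, derivative_C, derivative_add, derivative_sub,
    derivative_comp, derivative_bernoulli, derivative_X, zero_mul, zero_add, add_zero, mul_one,
    eval_mul, eval_C, eval_add, eval_sub, eval_comp, eval_X, mul_zero, eval_natCast,
    Nat.add_sub_cancel]
  push_cast
  field_simp

end ThetaIdentity

section ThetaAsymptotics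

open Filter Topology

/-- The trigonometric coefficients in the Fourier series of the theta coefficients. -/
noncomputable def thetaFourier (n : ℕ) : ℝ :=
  2 * Real.cos (2 * Real.pi * n * (1 / 12)) - 2 * Real.cos (2 * Real.pi * n * (5 / 12))

/-- The Dirichlet series `∑ thetaFourier n / n ^ (2 k)`. -/
noncomputable def thetaL (k : ℕ) : ℝ := ∑' n : ℕ, 1 / (n : ℝ) ^ (2 * k) * thetaFourier n

theorem hasSum_thetaL {k : ℕ} (hk : k ≠ 0) :
    HasSum (fun n : ℕ => 1 / (n : ℝ) ^ (2 * k) * thetaFourier n)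
      ((-1) ^ k * (2 * Real.pi) ^ (2 * k) / 2 / (2 * k).factorial *
        (((Polynomial.bernoulli (2 * k)).eval (7 / 12) -
        (Polynomial.bernoulli (2 * k)).eval (1 / 12) -
        (Polynomial.bernoulli (2 * k)).eval (11 / 12) +
        (Polynomial.bernoulli (2 * k)).eval (5 / 12) : ℚ) : ℝ)) := by
  have s7 : (Polynomial.bernoulli (2 * k)).eval (7 / 12 : ℚ) =
      (Polynomial.bernoulli (2 * k)).eval (5 / 12) := by
    have := Polynomial.bernoulli_eval_one_sub (2 * k) (5 / 12)
    norm_num at this; exact this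
  have s11 : (Polynomial.bernoulli (2 * k)).eval (11 / 12 : ℚ) =
      (Polynomial.bernoulli (2 * k)).eval (1 / 12) := by
    have := Polynomial.bernoulli_eval_one_sub (2 * k) (1 / 12)
    norm_num at this; exact this
  have c : ∀ x : ℚ, Polynomial.eval ((x : ℚ) : ℝ)
      (Polynomial.map (algebraMap ℚ ℝ) (Polynomial.bernoulli (2 * k))) =
      (((Polynomial.bernoulli (2 * k)).eval x : ℚ) : ℝ) := fun x =>
    Polynomial.eval_map_apply (algebraMap ℚ ℝ) x
  have h1 := hasSum_one_div_nat_pow_mul_cos hk (x := (1 / 12 : ℝ)) ⟨by norm_num, by norm_num⟩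
  have h5 := hasSum_one_div_nat_pow_mul_cos hk (x := (5 / 12 : ℝ)) ⟨by norm_num, by norm_num⟩
  have c1 := c (1 / 12)
  have c5 := c (5 / 12)
  push_cast at c1 c5
  rw [c1] at h1
  rw [c5] at h5
  rw [s7, s11]
  convert (h1.mul_left 2).sub (h5.mul_left 2) using 1
  · rfl
  · funext n; rw [thetaFourier]; ring
  · push_cast; ring

theorem abs_thetaFourier_le (n : ℕ) : |thetaFourier n| ≤ 4 := by
  rw [thetaFourier, abs_le]
  have h1 := Real.neg_one_le_cos (2 * Real.pi * n * (1 / 12))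
  have h2 := Real.cos_le_one (2 * Real.pi * n * (1 / 12))
  have h3 := Real.neg_one_le_cos (2 * Real.pi * n * (5 / 12))
  have h4 := Real.cos_le_one (2 * Real.pi * n * (5 / 12))
  constructor <;> linarith

theorem thetaFourier_one : thetaFourier 1 = 2 * Real.sqrt 3 := by
  have h1 : Real.cos (2 * Real.pi * (1 : ℕ) * (1 / 12)) = Real.sqrt 3 / 2 := by
    rw [← Real.cos_pi_div_six]; congr 1; push_cast; ring
  have h2 : Real.cos (2 * Real.pi * (1 : ℕ) * (5 / 12)) = -(Real.sqrt 3 / 2) := by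
    rw [← Real.cos_pi_div_six, ← Real.cos_pi_sub]; congr 1; push_cast; ring
  rw [thetaFourier, h1, h2]; ring

theorem tendsto_thetaL : Tendsto thetaL atTop (𝓝 (2 * Real.sqrt 3)) := by
  have hs : ∑' n : ℕ, (if n = 1 then 2 * Real.sqrt 3 else 0) = 2 * Real.sqrt 3 := by
    rw [tsum_ite_eq]
  rw [← hs]
  refine tendsto_tsum_of_dominated_convergence (bound := fun n : ℕ => 1 / (n : ℝ) ^ 2 * 4)
    ((Real.summable_one_div_nat_pow.2 (by norm_num)).mul_right 4) (fun n => ?_) ?_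
  · rcases eq_or_ne n 1 with rfl | h1
    · simp [thetaFourier_one]
    · rw [if_neg h1]
      rcases eq_or_ne n 0 with rfl | h0
      · refine tendsto_const_nhds.congr' ?_
        filter_upwards [eventually_gt_atTop 0] with k hk
        simp [hk.ne']
      · have hn : (2 : ℝ) ≤ n := by exact_mod_cast (by omega : 2 ≤ n)
        have hlt : (1 / (n : ℝ) ^ 2) < 1 := by
          rw [div_lt_one (by positivity)]; nlinarith
        have := (tendsto_pow_atTop_nhds_zero_of_lt_one (by positivity) hlt).mul_const
          (thetaFourier n)
        rw [zero_mul] at this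
        refine this.congr fun k => ?_
        rw [div_pow, one_pow, ← pow_mul]
  · filter_upwards [eventually_ge_atTop 1] with k hk n
    rw [norm_mul, Real.norm_eq_abs, Real.norm_eq_abs]
    gcongr ?_ * ?_
    · rcases eq_or_ne n 0 with rfl | h0
      · simp [show k ≠ 0 by omega]
      · have hn : (1 : ℝ) ≤ n := by exact_mod_cast Nat.one_le_iff_ne_zero.2 h0
        rw [abs_of_nonneg (by positivity)]
        gcongr 1 / ?_
        exact pow_le_pow_right₀ hn (by omega)
    · exact abs_thetaFourier_le n

theorem thetaL_pos {k : ℕ} (hk : k ≠ 0) : 0 < thetaL k := by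
  have h := (hasSum_thetaL hk).summable
  have hz := hasSum_zeta_two
  have hsum : Summable fun n : ℕ => 1 / (n : ℝ) ^ 2 * 4 := hz.summable.mul_right 4
  have e1 : thetaL k = 2 * Real.sqrt 3 +
      ∑' n : ℕ, 1 / ((n + 2 : ℕ) : ℝ) ^ (2 * k) * thetaFourier (n + 2) := by
    rw [thetaL, ← h.sum_add_tsum_nat_add 2]
    simp [Finset.sum_range_succ, thetaFourier_one, hk]
  have e2 : ∑' n : ℕ, 1 / ((n + 2 : ℕ) : ℝ) ^ 2 * 4 = Real.pi ^ 2 / 6 * 4 - 4 := by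
    have := hsum.sum_add_tsum_nat_add 2
    rw [(hz.mul_right 4).tsum_eq] at this
    simp only [Finset.sum_range_succ, Finset.sum_range_zero] at this
    norm_num at this ⊢
    linarith
  have e3 : |∑' n : ℕ, 1 / ((n + 2 : ℕ) : ℝ) ^ (2 * k) * thetaFourier (n + 2)| ≤
      ∑' n : ℕ, 1 / ((n + 2 : ℕ) : ℝ) ^ 2 * 4 := by
    have hsum2 : Summable fun n : ℕ => 1 / ((n + 2 : ℕ) : ℝ) ^ 2 * 4 :=
      (summable_nat_add_iff 2).2 hsum
    rw [← Real.norm_eq_abs]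
    refine tsum_of_norm_bounded hsum2.hasSum fun n => ?_
    rw [norm_mul, Real.norm_eq_abs, Real.norm_eq_abs]
    gcongr ?_ * ?_
    · rw [abs_of_nonneg (by positivity)]
      gcongr 1 / ?_
      exact pow_le_pow_right₀ (by norm_cast; omega) (by omega)
    · exact abs_thetaFourier_le _
  rw [e2] at e3
  have h1 := (abs_le.1 e3).1
  have h2 := Real.pi_lt_d2
  have h3 := Real.pi_pos
  have h4 : (1.7 : ℝ) < Real.sqrt 3 := Real.lt_sqrt_of_sq_lt (by norm_num)
  rw [e1]
  nlinarith

theorem derivative_thetaPoly_eval_real {k : ℕ} (hk : k ≠ 0) :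
    (((Polynomial.derivative (thetaPoly k)).eval 0 : ℚ) : ℝ) =
      (2 * k).factorial / k.factorial * (3 / (2 * Real.pi ^ 2)) ^ k * thetaL k := by
  rw [derivative_thetaPoly_eval_eq, thetaL, (hasSum_thetaL hk).tsum_eq]
  push_cast
  generalize (((Polynomial.bernoulli (2 * k)).eval (7 / 12 : ℚ) : ℚ) : ℝ) -
    (((Polynomial.bernoulli (2 * k)).eval (1 / 12 : ℚ) : ℚ) : ℝ) -
    (((Polynomial.bernoulli (2 * k)).eval (11 / 12 : ℚ) : ℚ) : ℝ) +
    (((Polynomial.bernoulli (2 * k)).eval (5 / 12 : ℚ) : ℚ) : ℝ) = y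
  have e : (3 / (2 * Real.pi ^ 2)) ^ k * ((-1) ^ k * (2 * Real.pi) ^ (2 * k)) = (-6 : ℝ) ^ k := by
    rw [pow_mul, ← mul_pow, ← mul_pow]
    congr 1
    have := Real.pi_ne_zero
    field_simp
    ring
  rw [← e]
  have : ((2 * k).factorial : ℝ) ≠ 0 := by positivity
  field_simp

/-- The Glaisher-type numbers `k! [t ^ k] exp (-t / 24) ∑ ∏ (1 - exp (-j t))`. -/
noncomputable def glaisher (k : ℕ) : ℝ :=
  k.factorial * (((Polynomial.derivative (thetaPoly (k + 1))).eval 0 : ℚ) : ℝ)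

theorem glaisher_pos (k : ℕ) : 0 < glaisher k := by
  rw [glaisher, derivative_thetaPoly_eval_real k.succ_ne_zero]
  have := thetaL_pos k.succ_ne_zero
  have := Real.pi_pos
  positivity

theorem tendsto_glaisher :
    Tendsto (fun m : ℕ => ((m : ℝ) + 1) ^ 2 * glaisher m / glaisher (m + 1)) atTop
      (𝓝 (Real.pi ^ 2 / 6)) := by
  have h1 : Tendsto (fun m : ℕ => 1 + 1 / (2 * ((m : ℝ) + 1))) atTop (𝓝 (1 + 0)) := by
    refine tendsto_const_nhds.add ?_
    have := (tendsto_one_div_add_atTop_nhds_zero_nat (𝕜 := ℝ)).mul_const (1 / 2)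
    rw [zero_mul] at this
    exact this.congr fun m => by field_simp
  have hL : (2 * Real.sqrt 3 : ℝ) ≠ 0 := by positivity
  have h2 := ((tendsto_thetaL.comp (tendsto_add_atTop_nat 1)).div
    (tendsto_thetaL.comp (tendsto_add_atTop_nat 2)) hL).div h1 (by norm_num)
  have h3 := h2.const_mul (Real.pi ^ 2 / 6)
  rw [div_self hL, add_zero, div_one, mul_one] at h3
  refine h3.congr fun m => ?_
  have hp1 := (thetaL_pos (m + 1).succ_ne_zero).ne'
  have hpi := Real.pi_ne_zero
  rw [glaisher, glaisher, derivative_thetaPoly_eval_real m.succ_ne_zero,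
    derivative_thetaPoly_eval_real (m + 1).succ_ne_zero]
  have f1 : 2 * (m + 1 + 1) = 2 * (m + 1) + 1 + 1 := by ring
  simp only [Function.comp, Pi.div_apply, Nat.succ_eq_add_one] at *
  rw [f1, Nat.factorial_succ (2 * (m + 1) + 1), Nat.factorial_succ (2 * (m + 1)),
    Nat.factorial_succ (m + 1), Nat.factorial_succ m, pow_succ _ (m + 1)]
  push_cast
  have : ((2 * (m + 1)).factorial : ℝ) ≠ 0 := by positivity
  have : (m.factorial : ℝ) ≠ 0 := by positivity
  have : (2 * ((m : ℝ) + 1) + 1) ≠ 0 := by positivity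
  rw [show m + 1 + 1 = m + 2 from rfl] at *
  field_simp
  ring

end ThetaAsymptotics

section Transfer

open Filter Topology

theorem descFactorial_sq_mul_le {v : ℕ → ℝ} {K : ℝ} (hK : 0 ≤ K)
    (h : ∀ m : ℕ, ((m : ℝ) + 1) ^ 2 * v m ≤ K * v (m + 1)) {n j : ℕ} (hj : j ≤ n) :
    (n.descFactorial j : ℝ) ^ 2 * v (n - j) ≤ K ^ j * v n := by
  induction j with
  | zero => simp
  | succ j ih =>
    have h1 := h (n - (j + 1))
    have e : n - (j + 1) + 1 = n - j := by omega
    have e' : ((n - (j + 1) : ℕ) : ℝ) + 1 = ((n - j : ℕ) : ℝ) := by exact_mod_cast e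
    rw [e, e'] at h1
    rw [Nat.descFactorial_succ]
    push_cast
    calc _ = (n.descFactorial j : ℝ) ^ 2 * (((n - j : ℕ) : ℝ) ^ 2 * v (n - (j + 1))) := by ring
      _ ≤ (n.descFactorial j : ℝ) ^ 2 * (K * v (n - j)) := by gcongr
      _ = K * ((n.descFactorial j : ℝ) ^ 2 * v (n - j)) := by ring
      _ ≤ K * (K ^ j * v n) := mul_le_mul_of_nonneg_left (ih (by omega)) hK
      _ = _ := by ring

theorem tendsto_natCast_div_natCast_sub (j : ℕ) :
    Tendsto (fun n : ℕ => (n : ℝ) / ((n - j : ℕ) : ℝ)) atTop (𝓝 1) := by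
  have h : Tendsto (fun n : ℕ => 1 + (j : ℝ) / ((n - j : ℕ) : ℝ)) atTop (𝓝 (1 + 0)) :=
    tendsto_const_nhds.add ((tendsto_const_div_atTop_nhds_zero_nat (j : ℝ)).comp
      (tendsto_sub_atTop_nat j))
  rw [add_zero] at h
  refine h.congr' ?_
  filter_upwards [eventually_gt_atTop j] with n hn
  have : ((n - j : ℕ) : ℝ) ≠ 0 := by
    have : n - j ≠ 0 := by omega
    exact_mod_cast this
  field_simp
  rw [Nat.cast_sub hn.le]
  ring

theorem tendsto_pow_mul_div {v : ℕ → ℝ} (hv : ∀ m, 0 < v m) {μ : ℝ}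
    (h : Tendsto (fun m : ℕ => ((m : ℝ) + 1) ^ 2 * v m / v (m + 1)) atTop (𝓝 μ)) (j : ℕ) :
    Tendsto (fun n : ℕ => (n : ℝ) ^ (2 * j) * v (n - j) / v n) atTop (𝓝 (μ ^ j)) := by
  induction j with
  | zero => simp [fun n => div_self (hv n).ne']
  | succ j ih =>
    have h1 := (ih.mul ((tendsto_natCast_div_natCast_sub j).pow 2)).mul
      (h.comp (tendsto_sub_atTop_nat (j + 1)))
    rw [one_pow, mul_one, ← pow_succ] at h1
    refine h1.congr' ?_
    filter_upwards [eventually_gt_atTop j] with n hn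
    have e : n - (j + 1) + 1 = n - j := by omega
    have e' : ((n - (j + 1) : ℕ) : ℝ) + 1 = ((n - j : ℕ) : ℝ) := by exact_mod_cast e
    have h0 : ((n - j : ℕ) : ℝ) ≠ 0 := by
      have : n - j ≠ 0 := by omega
      exact_mod_cast this
    have h2 := (hv n).ne'
    have h3 := (hv (n - j)).ne'
    simp only [Function.comp, e, e']
    field_simp
    ring

/-- A Tannery-type transfer of asymptotics for sequences growing like `n! ^ 2 / μ ^ n`. -/
theorem tendsto_sum_transfer {v : ℕ → ℝ} (hv : ∀ m, 0 < v m) {μ : ℝ}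
    (h : Tendsto (fun m : ℕ => ((m : ℝ) + 1) ^ 2 * v m / v (m + 1)) atTop (𝓝 μ))
    {κ : ℕ → ℕ → ℝ} {κ' : ℕ → ℝ}
    (hb : ∀ n j, j ≤ n → |κ n j| ≤ (n.descFactorial j : ℝ) ^ 2 / j.factorial)
    (hl : ∀ j, Tendsto (fun n : ℕ => κ n j / (n : ℝ) ^ (2 * j)) atTop (𝓝 (κ' j))) :
    Tendsto (fun n => (∑ j ∈ Finset.range (n + 1), κ n j * v (n - j)) / v n) atTop
      (𝓝 (∑' j, κ' j * μ ^ j)) := by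
  obtain ⟨K, hK⟩ := h.bddAbove_range
  have hK' : ∀ m : ℕ, ((m : ℝ) + 1) ^ 2 * v m ≤ K * v (m + 1) := fun m => by
    have := hK ⟨m, rfl⟩
    exact (div_le_iff₀ (hv _)).1 this
  have hK0 : 0 ≤ K := by
    have h1 := hK' 0
    by_contra! hneg
    have := mul_neg_of_neg_of_pos hneg (hv 1)
    have := hv 0
    norm_num at h1
    linarith
  let f : ℕ → ℕ → ℝ := fun n j => if j ≤ n then κ n j * v (n - j) / v n else 0
  have key : Tendsto (fun n => ∑' j, f n j) atTop (𝓝 (∑' j, κ' j * μ ^ j)) := by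
    refine tendsto_tsum_of_dominated_convergence (bound := fun j => K ^ j / j.factorial)
      (Real.summable_pow_div_factorial K) (fun j => ?_) (Eventually.of_forall fun n j => ?_)
    · refine ((hl j).mul (tendsto_pow_mul_div hv h j)).congr' ?_
      filter_upwards [eventually_ge_atTop j, eventually_gt_atTop 0] with n hn hn0
      simp only [f, if_pos hn]
      have : (n : ℝ) ^ (2 * j) ≠ 0 := by positivity
      have := (hv n).ne'
      field_simp
    · simp only [f]
      split_ifs with hjn
      · rw [Real.norm_eq_abs, abs_div, abs_mul, abs_of_pos (hv _), abs_of_pos (hv n),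
          div_le_iff₀ (hv n)]
        calc _ ≤ (n.descFactorial j : ℝ) ^ 2 / j.factorial * v (n - j) := by
              gcongr
              · exact (hv _).le
              · exact hb n j hjn
          _ = (n.descFactorial j : ℝ) ^ 2 * v (n - j) / j.factorial := by ring
          _ ≤ K ^ j * v n / j.factorial :=
              div_le_div_of_nonneg_right (descFactorial_sq_mul_le hK0 hK' hjn) (by positivity)
          _ = _ := by ring
      · rw [norm_zero]; positivity
  refine key.congr fun n => ?_
  rw [tsum_eq_sum (s := Finset.range (n + 1)), Finset.sum_div]
  · refine Finset.sum_congr rfl fun j hj => ?_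
    simp only [f, if_pos (Nat.lt_succ_iff.1 (Finset.mem_range.1 hj))]
  · intro j hj
    simp only [f]
    rw [if_neg]
    simpa using hj

theorem tendsto_binomial_transform {v : ℕ → ℝ} (hv : ∀ m, 0 < v m) {μ : ℝ}
    (h : Tendsto (fun m : ℕ => ((m : ℝ) + 1) ^ 2 * v m / v (m + 1)) atTop (𝓝 μ))
    {a : ℝ} (ha : |a| ≤ 1) :
    Tendsto (fun n => (∑ j ∈ Finset.range (n + 1), n.choose j * a ^ j * v (n - j)) / v n) atTop
      (𝓝 1) := by
  have hle : ∀ n j : ℕ, (n.choose j : ℝ) ≤ (n : ℝ) ^ j := fun n j => by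
    exact_mod_cast Nat.choose_le_pow n j
  have := tendsto_sum_transfer hv h (κ := fun n j => n.choose j * a ^ j)
    (κ' := fun j => if j = 0 then 1 else 0) (fun n j hj => ?_) (fun j => ?_)
  · convert this using 2
    rw [tsum_eq_single 0]
    · simp
    · intro j hj; simp [hj]
  · rw [abs_mul, abs_pow, Nat.abs_cast, le_div_iff₀ (by positivity)]
    have h1 : (n.descFactorial j : ℝ) = n.choose j * j.factorial := by
      rw [Nat.descFactorial_eq_factorial_mul_choose]; push_cast; ring
    have h2 : (1 : ℝ) ≤ n.descFactorial j := by
      exact_mod_cast Nat.descFactorial_pos.2 hj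
    have h3 : |a| ^ j ≤ 1 := pow_le_one₀ (abs_nonneg a) ha
    calc (n.choose j : ℝ) * |a| ^ j * j.factorial = |a| ^ j * n.descFactorial j := by rw [h1]; ring
      _ ≤ 1 * n.descFactorial j := by gcongr
      _ ≤ _ := by nlinarith
  · rcases eq_or_ne j 0 with rfl | hj
    · simp
    · simp only [if_neg hj]
      have hz : Tendsto (fun n : ℕ => (1 / (n : ℝ)) ^ j) atTop (𝓝 0) := by
        have := (tendsto_const_div_atTop_nhds_zero_nat (1 : ℝ)).pow j
        rwa [zero_pow hj] at this
      refine squeeze_zero_norm' ?_ hz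
      filter_upwards [eventually_gt_atTop 0] with n hn
      have hn' : (0 : ℝ) < n := by exact_mod_cast hn
      have h3 : |a| ^ j ≤ 1 := pow_le_one₀ (abs_nonneg a) ha
      rw [Real.norm_eq_abs, abs_div, abs_mul, abs_pow, Nat.abs_cast,
        abs_of_nonneg (show (0 : ℝ) ≤ (n : ℝ) ^ (2 * j) by positivity), div_le_iff₀ (by positivity)]
      calc _ ≤ (n : ℝ) ^ j * 1 :=
            mul_le_mul (hle n j) h3 (pow_nonneg (abs_nonneg a) j) (by positivity)
        _ = _ := by rw [two_mul, pow_add, div_pow, one_pow]; field_simp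

end Transfer

section Stirling

open Filter Topology

/-- The elementary symmetric function of degree `j` in `0, 1, …, n - 1`, that is the unsigned
Stirling number of the first kind `c(n, n - j)`. -/
def stirlingEsymm : ℕ → ℕ → ℕ
  | _, 0 => 1
  | 0, _ + 1 => 0
  | n + 1, j + 1 => stirlingEsymm n (j + 1) + n * stirlingEsymm n j

theorem stirlingEsymm_zero_right (n : ℕ) : stirlingEsymm n 0 = 1 := by
  cases n <;> rfl

theorem stirlingEsymm_eq_zero {n j : ℕ} (h : n < j) : stirlingEsymm n j = 0 := by
  induction n generalizing j with
  | zero => obtain ⟨j, rfl⟩ := Nat.exists_eq_succ_of_ne_zero h.ne'; rfl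
  | succ n ih =>
    obtain ⟨j, rfl⟩ := Nat.exists_eq_succ_of_ne_zero (by omega : j ≠ 0)
    rw [Nat.succ_eq_add_one, stirlingEsymm, ih (by omega), ih (by omega), mul_zero, add_zero]

theorem prod_add_mul_eq_sum {R : Type*} [CommRing R] (y ε : R) (n : ℕ) :
    ∏ i ∈ Finset.range n, (y + ε * i) =
      ∑ j ∈ Finset.range (n + 1), ε ^ j * stirlingEsymm n j * y ^ (n - j) := by
  induction n with
  | zero => simp [stirlingEsymm]
  | succ n ih =>
    rw [Finset.prod_range_succ, ih, Finset.sum_range_succ' _ (n + 1)]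
    simp only [stirlingEsymm]
    have h1 : ∑ j ∈ Finset.range (n + 1), ε ^ j * stirlingEsymm n j * y ^ (n - j) * y =
        ∑ j ∈ Finset.range (n + 1), ε ^ (j + 1) * stirlingEsymm n (j + 1) * y ^ (n - j) +
          y ^ (n + 1) := by
      rw [Finset.sum_range_succ', Finset.sum_range_succ _ n, stirlingEsymm_eq_zero n.lt_succ_self]
      simp only [stirlingEsymm_zero_right]
      rw [Nat.cast_zero, mul_zero, zero_mul, add_zero]
      congr 1
      · refine Finset.sum_congr rfl fun j hj => ?_
        have : n - j = n - (j + 1) + 1 := by have := Finset.mem_range.1 hj; omega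
        rw [this]; ring
      · simp [pow_succ]
    rw [mul_add, Finset.sum_mul, h1, Finset.sum_mul, add_right_comm, ← Finset.sum_add_distrib]
    congr 1
    · refine Finset.sum_congr rfl fun j _ => ?_
      rw [Nat.add_sub_add_right]; push_cast; ring
    · simp

theorem stirlingEsymm_mul_factorial_le (n j : ℕ) :
    stirlingEsymm n j * j.factorial ≤ n.descFactorial j ^ 2 := by
  induction n generalizing j with
  | zero => cases j <;> simp [stirlingEsymm]
  | succ n ih =>
    rcases j with _ | j
    · simp [stirlingEsymm]
    · rcases lt_or_ge n j with h | h
      · rw [stirlingEsymm_eq_zero (by omega)]; simp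
      · obtain ⟨d, rfl⟩ := Nat.exists_eq_add_of_le h
        rw [stirlingEsymm, Nat.succ_descFactorial_succ]
        have h1 := ih j
        have h2 := ih (j + 1)
        rw [Nat.descFactorial_succ, Nat.add_sub_cancel_left] at h2
        rw [Nat.factorial_succ] at h2 ⊢
        generalize (j + d).descFactorial j = D at *
        calc _ = stirlingEsymm (j + d) (j + 1) * ((j + 1) * j.factorial) +
              (j + d) * (j + 1) * (stirlingEsymm (j + d) j * j.factorial) := by ring
          _ ≤ (d * D) ^ 2 + (j + d) * (j + 1) * D ^ 2 := by gcongr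
          _ = (d ^ 2 + (j + d) * (j + 1)) * D ^ 2 := by ring
          _ ≤ (j + d + 1) ^ 2 * D ^ 2 := by gcongr; nlinarith
          _ = _ := by ring

theorem tendsto_sum_range_pow_div (p : ℕ) :
    Tendsto (fun n : ℕ => (∑ m ∈ Finset.range n, (m : ℝ) ^ p) / (n : ℝ) ^ (p + 1)) atTop
      (𝓝 (1 / (p + 1))) := by
  have h : Tendsto (fun n : ℕ => ∑ i ∈ Finset.range (p + 1),
      ((bernoulli i : ℚ) : ℝ) * ((p + 1).choose i) * (1 / (n : ℝ)) ^ i / (p + 1)) atTop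
      (𝓝 (∑ i ∈ Finset.range (p + 1),
        ((bernoulli i : ℚ) : ℝ) * ((p + 1).choose i) * 0 ^ i / (p + 1))) := by
    refine tendsto_finsetSum _ fun i _ => ?_
    exact (((tendsto_const_div_atTop_nhds_zero_nat (1 : ℝ)).pow i).const_mul _).div_const _
  rw [Finset.sum_range_succ'] at h
  simp only [pow_succ, mul_zero, zero_div, Finset.sum_const_zero, pow_zero, bernoulli_zero,
    Nat.choose_zero_right, zero_add, Nat.cast_one, Rat.cast_one, mul_one] at h
  refine h.congr' ?_
  filter_upwards [eventually_gt_atTop 0] with n hn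
  have hn' : (n : ℝ) ≠ 0 := by exact_mod_cast hn.ne'
  have := congrArg (fun q : ℚ => (q : ℝ)) (sum_range_pow n p)
  push_cast at this
  rw [this, Finset.sum_div]
  refine Finset.sum_congr rfl fun i hi => ?_
  have hi' : p + 1 = p + 1 - i + i := by have := Finset.mem_range.1 hi; omega
  have e : (n : ℝ) ^ (p + 1) = (n : ℝ) ^ (p + 1 - i) * (n : ℝ) ^ i := by
    rw [← pow_add, ← hi']
  rw [e, div_pow, one_pow]
  have : (n : ℝ) ^ (p + 1 - i) ≠ 0 := pow_ne_zero _ hn'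
  field_simp

theorem tendsto_sum_range_div_of_tendsto {f : ℕ → ℝ} {p : ℕ} {L : ℝ} (hp : p ≠ 0) (h0 : f 0 = 0)
    (h : Tendsto (fun n : ℕ => f n / (n : ℝ) ^ p) atTop (𝓝 L)) :
    Tendsto (fun n : ℕ => (∑ m ∈ Finset.range n, f m) / (n : ℝ) ^ (p + 1)) atTop
      (𝓝 (L / (p + 1))) := by
  have h1 : (fun n : ℕ => f n - L * (n : ℝ) ^ p) =o[atTop] fun n : ℕ => (n : ℝ) ^ p := by
    rw [Asymptotics.isLittleO_iff_tendsto]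
    · have := h.sub_const L
      rw [sub_self] at this
      refine this.congr' ?_
      filter_upwards [eventually_gt_atTop 0] with n hn
      have : (n : ℝ) ^ p ≠ 0 := by positivity
      field_simp
    · intro n hn
      have : n = 0 := by simpa [hp] using hn
      subst this
      simp [h0, hp]
  have hd : Tendsto (fun n : ℕ => ∑ m ∈ Finset.range n, (m : ℝ) ^ p) atTop atTop := by
    refine tendsto_atTop_mono (fun n => ?_) (tendsto_atTop_add_const_right _ (-1)
      tendsto_natCast_atTop_atTop)
    rcases n with _ | n
    · simp
    · have := Finset.sum_le_sum (s := Finset.range n) (f := fun _ => (1 : ℝ))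
        (g := fun m => ((m + 1 : ℕ) : ℝ) ^ p)
        (fun m _ => one_le_pow₀ (by push_cast; linarith [m.cast_nonneg (α := ℝ)]))
      rw [Finset.sum_range_succ']
      simp only [Finset.sum_const, Finset.card_range, nsmul_eq_mul, mul_one] at this
      simp only [Nat.cast_zero, zero_pow hp, add_zero]
      push_cast at this ⊢
      linarith
  have h2 := h1.sum_range (fun n => by positivity) hd
  have hne : ∀ᶠ n : ℕ in atTop, ∑ m ∈ Finset.range n, (m : ℝ) ^ p ≠ 0 := hd.eventually_ne_atTop 0
  have h3 := (h2.tendsto_div_nhds_zero.add_const L).mul (tendsto_sum_range_pow_div p)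
  rw [zero_add, mul_one_div] at h3
  refine h3.congr' ?_
  filter_upwards [hne] with n hn
  rw [Finset.sum_sub_distrib, ← Finset.mul_sum]
  field_simp
  ring

theorem stirlingEsymm_succ_eq_sum (n j : ℕ) :
    stirlingEsymm n (j + 1) = ∑ m ∈ Finset.range n, m * stirlingEsymm m j := by
  induction n with
  | zero => rfl
  | succ n ih => rw [stirlingEsymm, Finset.sum_range_succ, ih]

theorem tendsto_stirlingEsymm_div (j : ℕ) :
    Tendsto (fun n : ℕ => (stirlingEsymm n j : ℝ) / (n : ℝ) ^ (2 * j)) atTop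
      (𝓝 ((1 / 2) ^ j / j.factorial)) := by
  induction j with
  | zero => simp [stirlingEsymm_zero_right]
  | succ j ih =>
    have := tendsto_sum_range_div_of_tendsto (f := fun m => (m : ℝ) * stirlingEsymm m j)
      (p := 2 * j + 1) (L := (1 / 2) ^ j / j.factorial) (by omega) (by simp) ?_
    · convert this using 2
      · rw [stirlingEsymm_succ_eq_sum]; push_cast; rfl
      · rw [Nat.factorial_succ]; push_cast; field_simp; ring
    · refine ih.congr' ?_
      filter_upwards [eventually_gt_atTop 0] with n hn
      rw [pow_succ]
      field_simp

theorem tendsto_stirling_transform {v : ℕ → ℝ} (hv : ∀ m, 0 < v m) {μ : ℝ}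
    (h : Tendsto (fun m : ℕ => ((m : ℝ) + 1) ^ 2 * v m / v (m + 1)) atTop (𝓝 μ))
    {ε : ℝ} (hε : |ε| = 1) :
    Tendsto (fun n => (∑ j ∈ Finset.range (n + 1), ε ^ j * stirlingEsymm n j * v (n - j)) / v n)
      atTop (𝓝 (Real.exp (ε * μ / 2))) := by
  have := tendsto_sum_transfer hv h (κ := fun n j => ε ^ j * stirlingEsymm n j)
    (κ' := fun j => ε ^ j * ((1 / 2) ^ j / j.factorial)) (fun n j _ => ?_) (fun j => ?_)
  · convert this using 2
    rw [Real.exp_eq_exp_ℝ, NormedSpace.exp_eq_tsum_div]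
    refine tsum_congr fun j => ?_
    rw [div_pow, mul_pow, div_pow, one_pow]
    field_simp
  · rw [abs_mul, abs_pow, hε, one_pow, one_mul, Nat.abs_cast, le_div_iff₀ (by positivity)]
    exact_mod_cast stirlingEsymm_mul_factorial_le n j
  · exact ((tendsto_stirlingEsymm_div j).const_mul (ε ^ j)).congr fun n => by ring

end Stirling

section FishburnRepresentation

/-- A multiset of integer intervals is Fishburn with magnitude `k` if both the left endpoints and
the right endpoints are exactly `0, …, k - 1`. Such multisets encode Fishburn matrices. -/
def IsFishburn (k : ℕ) (s : Multiset (ℕ × ℕ)) : Prop :=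
  (∀ p ∈ s, p.1 ≤ p.2) ∧ (∀ i, i < k ↔ ∃ p ∈ s, p.1 = i) ∧ ∀ i, i < k ↔ ∃ p ∈ s, p.2 = i

/-- The function `f` is a representation of the interval order `P` by integer intervals whose left
endpoints and right endpoints both fill an initial segment. -/
def IsFishburnRep {n : ℕ} (P : IntervalOrderRel n) (f : Fin n → ℕ × ℕ) : Prop :=
  (∀ a b, P.1 a b ↔ (f a).2 < (f b).1) ∧
    ∃ k, (∀ i, i < k ↔ ∃ x, (f x).1 = i) ∧ ∀ i, i < k ↔ ∃ x, (f x).2 = i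

theorem eq_of_le_iff_le_of_initial {α : Type*} {f g : α → ℕ} (h : ∀ x y, f x ≤ f y ↔ g x ≤ g y)
    (hf : ∃ k, ∀ i, i < k ↔ ∃ x, f x = i) (hg : ∃ k, ∀ i, i < k ↔ ∃ x, g x = i) : f = g := by
  have key : ∀ f g : α → ℕ, (∀ x y, f x ≤ f y ↔ g x ≤ g y) →
      (∃ k, ∀ i, i < k ↔ ∃ x, f x = i) → ∀ m x, f x = m → m ≤ g x := by
    intro f g h ⟨k, hk⟩ m
    induction m with
    | zero => intros; exact Nat.zero_le _
    | succ m ih =>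
      intro x hx
      have hlt : m + 1 < k := (hk _).2 ⟨x, hx⟩
      obtain ⟨y, hy⟩ := (hk m).1 (by omega)
      have h1 := ih y hy
      have h2 : ¬ g x ≤ g y := fun hle => by
        have := (h x y).2 hle
        omega
      omega
  funext x
  exact le_antisymm (key f g h hf _ x rfl) (key g f (fun x y => (h x y).symm) hg _ x rfl)

theorem IsFishburnRep.eq {n : ℕ} {P : IntervalOrderRel n} {f g : Fin n → ℕ × ℕ}
    (hf : IsFishburnRep P f) (hg : IsFishburnRep P g) : f = g := by
  have key1 : ∀ f : Fin n → ℕ × ℕ, IsFishburnRep P f → ∀ x y,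
      (f x).1 ≤ (f y).1 ↔ ∀ a, P.1 a x → P.1 a y := by
    rintro f ⟨hr, k, h1, h2⟩ x y
    refine ⟨fun h a hax => (hr a y).2 (((hr a x).1 hax).trans_le h), fun h => ?_⟩
    by_contra! hlt
    obtain ⟨a, ha⟩ := (h2 (f y).1).1 ((h1 _).2 ⟨y, rfl⟩)
    have := (hr a y).1 (h a ((hr a x).2 (by omega)))
    omega
  have key2 : ∀ f : Fin n → ℕ × ℕ, IsFishburnRep P f → ∀ x y,
      (f x).2 ≤ (f y).2 ↔ ∀ a, P.1 y a → P.1 x a := by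
    rintro f ⟨hr, k, h1, h2⟩ x y
    refine ⟨fun h a hya => (hr x a).2 (h.trans_lt ((hr y a).1 hya)), fun h => ?_⟩
    by_contra! hlt
    obtain ⟨a, ha⟩ := (h1 (f x).2).1 ((h2 _).2 ⟨x, rfl⟩)
    have := (hr x a).1 (h a ((hr y a).2 (by omega)))
    omega
  have e1 : (fun x => (f x).1) = fun x => (g x).1 :=
    eq_of_le_iff_le_of_initial (fun x y => (key1 f hf x y).trans (key1 g hg x y).symm)
      ⟨_, hf.2.choose_spec.1⟩ ⟨_, hg.2.choose_spec.1⟩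
  have e2 : (fun x => (f x).2) = fun x => (g x).2 :=
    eq_of_le_iff_le_of_initial (fun x y => (key2 f hf x y).trans (key2 g hg x y).symm)
      ⟨_, hf.2.choose_spec.2⟩ ⟨_, hg.2.choose_spec.2⟩
  funext x
  exact Prod.ext (congrFun e1 x) (congrFun e2 x)

theorem exists_isFishburnRep {n : ℕ} (P : IntervalOrderRel n) : ∃ f, IsFishburnRep P f := by
  obtain ⟨r, hr, h22⟩ := P
  have hirr : ∀ a, ¬ r a a := hr.irrefl
  let D : Fin n → Finset (Fin n) := fun x => Finset.univ.filter fun y => r y x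
  have hD : ∀ a x, a ∈ D x ↔ r a x := fun a x => by simp [D]
  have hchain : ∀ x y, D x ⊆ D y ∨ D y ⊂ D x := by
    intro x y
    by_contra! h
    obtain ⟨h1, h2⟩ := h
    obtain ⟨a, ha, hay⟩ := Finset.not_subset.1 h1
    have : ¬ D y ⊆ D x := fun hs => h2 ⟨hs, h1⟩
    obtain ⟨b, hb, hbx⟩ := Finset.not_subset.1 this
    rw [hD] at ha hay hb hbx
    exact (h22 a x b y ha hb).elim hay hbx
  let dom : Finset (Finset (Fin n)) := Finset.univ.image D
  have hdom : ∀ x, D x ∈ dom := fun x => Finset.mem_image_of_mem _ (Finset.mem_univ _)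
  let l : Fin n → ℕ := fun x => (dom.filter fun E => E ⊂ D x).card
  let u : Fin n → ℕ := fun x => (dom.filter fun E => x ∉ E).card - 1
  have hlmono : ∀ x y, D x ⊂ D y → l x < l y := by
    intro x y hxy
    refine Finset.card_lt_card ⟨fun E hE => ?_, fun hs => ?_⟩
    · rw [Finset.mem_filter] at hE ⊢
      exact ⟨hE.1, hE.2.trans hxy⟩
    · have := hs (Finset.mem_filter.2 ⟨hdom x, hxy⟩)
      exact (Finset.mem_filter.1 this).2.ne rfl
  have hrep : ∀ a b, r a b ↔ u a < l b := by
    intro a b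
    have h1 : 1 ≤ (dom.filter fun E => a ∉ E).card :=
      Finset.card_pos.2 ⟨D a, Finset.mem_filter.2 ⟨hdom a, by rw [hD]; exact hirr a⟩⟩
    constructor
    · intro hab
      have : (dom.filter fun E => a ∉ E).card ≤ l b := by
        refine Finset.card_le_card fun E hE => ?_
        rw [Finset.mem_filter] at hE ⊢
        refine ⟨hE.1, ?_⟩
        obtain ⟨x, -, rfl⟩ := Finset.mem_image.1 hE.1
        exact (hchain b x).resolve_left fun hs => hE.2 (hs ((hD a b).2 hab))
      simp only [u]
      omega
    · intro hlt
      by_contra hab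
      have : l b < (dom.filter fun E => a ∉ E).card := by
        refine Finset.card_lt_card ⟨fun E hE => ?_, fun hs => ?_⟩
        · rw [Finset.mem_filter] at hE ⊢
          exact ⟨hE.1, fun ha => hab ((hD a b).1 (hE.2.1 ha))⟩
        · have := hs (Finset.mem_filter.2 ⟨hdom b, by rwa [hD]⟩)
          exact (Finset.mem_filter.1 this).2.ne rfl
      simp only [u] at hlt
      omega
  have hlk : ∀ x, l x < dom.card := fun x => by
    refine Finset.card_lt_card ⟨Finset.filter_subset _ _, fun hs => ?_⟩
    exact (Finset.mem_filter.1 (hs (hdom x))).2.ne rfl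
  have huk : ∀ x, u x < dom.card := fun x => by
    have h1 : (dom.filter fun E => x ∉ E).card ≤ dom.card := Finset.card_filter_le _ _
    have h2 : 0 < dom.card := Finset.card_pos.2 ⟨_, hdom x⟩
    simp only [u]
    omega
  have hlimage : Finset.univ.image l = Finset.range dom.card := by
    refine Finset.eq_of_subset_of_card_le (fun i hi => ?_) ?_
    · obtain ⟨x, -, rfl⟩ := Finset.mem_image.1 hi
      exact Finset.mem_range.2 (hlk x)
    · rw [Finset.card_range]
      refine Finset.card_le_card_of_surjOn
        (fun i => if h : ∃ x, l x = i then D h.choose else ∅) fun E hE => ?_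
      obtain ⟨x, -, rfl⟩ := Finset.mem_image.1 hE
      refine ⟨l x, Finset.mem_coe.2 (Finset.mem_image_of_mem _ (Finset.mem_univ _)), ?_⟩
      have h : ∃ y, l y = l x := ⟨x, rfl⟩
      simp only [dif_pos h]
      have hs := h.choose_spec
      by_contra hne
      rcases hchain h.choose x with h1 | h1
      · have := hlmono _ _ (h1.ssubset_of_ne hne); omega
      · have := hlmono _ _ h1; omega
  have hl : ∀ i, i < dom.card ↔ ∃ x, l x = i := fun i => by
    rw [← Finset.mem_range, ← hlimage]; simp
  refine ⟨fun x => (l x, u x), hrep, dom.card, hl, fun i => ⟨fun hi => ?_, ?_⟩⟩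
  · by_contra! hne
    obtain ⟨y, hy⟩ := (hl i).1 hi
    rcases Nat.lt_or_ge (i + 1) dom.card with h | h
    · obtain ⟨z, hz⟩ := (hl (i + 1)).1 h
      have : D z = D y := by
        ext a
        have := hne a
        rw [hD, hD, hrep, hrep, hz, hy]
        simp only at this
        omega
      have : l z = l y := by simp only [l, this]
      omega
    · refine hirr y ((hrep y y).2 ?_)
      have h1 := huk y
      have h2 := hne y
      simp only at h2
      omega
  · rintro ⟨x, rfl⟩
    exact huk x

/-- The canonical representation of an interval order. -/
noncomputable def fishburnRep {n : ℕ} (P : IntervalOrderRel n) : Fin n → ℕ × ℕ :=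
  (exists_isFishburnRep P).choose

theorem isFishburnRep_fishburnRep {n : ℕ} (P : IntervalOrderRel n) :
    IsFishburnRep P (fishburnRep P) :=
  (exists_isFishburnRep P).choose_spec

/-- The multiset of intervals in the canonical representation of an interval order. -/
noncomputable def fishburnMultiset {n : ℕ} (P : IntervalOrderRel n) : Multiset (ℕ × ℕ) :=
  Finset.univ.val.map (fishburnRep P)

theorem fishburnRep_comp {n : ℕ} {P Q : IntervalOrderRel n} {e : Equiv.Perm (Fin n)}
    (he : ∀ a b, P.1 a b ↔ Q.1 (e a) (e b)) : fishburnRep P = fishburnRep Q ∘ e := by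
  refine (isFishburnRep_fishburnRep P).eq ?_
  obtain ⟨hr, k, h1, h2⟩ := isFishburnRep_fishburnRep Q
  refine ⟨fun a b => (he a b).trans (hr _ _), k, fun i => (h1 i).trans ?_,
    fun i => (h2 i).trans ?_⟩ <;>
  exact ⟨fun ⟨x, hx⟩ => ⟨e.symm x, by simpa using hx⟩, fun ⟨x, hx⟩ => ⟨e x, hx⟩⟩

theorem exists_perm_comp_eq_of_map_univ_eq {α β : Type*} [Fintype α] {f g : α → β}
    (h : Finset.univ.val.map f = Finset.univ.val.map g) :
    ∃ e : Equiv.Perm α, f = g ∘ e := by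
  have hcard : ∀ c, Fintype.card {a // f a = c} = Fintype.card {a // g a = c} := fun c => by
    have := congrArg (Multiset.count c) h
    rw [Multiset.count_map, Multiset.count_map, ← Finset.filter_val, ← Finset.filter_val] at this
    rw [Fintype.card_subtype, Fintype.card_subtype]
    simpa only [eq_comm, Finset.card_val] using this
  refine ⟨Equiv.ofFiberEquiv fun c => Fintype.equivOfCardEq (hcard c), funext fun a => ?_⟩
  exact (Equiv.ofFiberEquiv_map _ a).symm

theorem fishburnMultiset_eq_iff {n : ℕ} {P Q : IntervalOrderRel n} :
    fishburnMultiset P = fishburnMultiset Q ↔ IntervalOrderIso P Q := by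
  constructor
  · intro h
    obtain ⟨e, he⟩ := exists_perm_comp_eq_of_map_univ_eq h
    refine ⟨e, fun a b => ?_⟩
    rw [(isFishburnRep_fishburnRep P).1, (isFishburnRep_fishburnRep Q).1, he]
    rfl
  · rintro ⟨e, he⟩
    rw [fishburnMultiset, fishburnMultiset, fishburnRep_comp he, ← Multiset.map_map]
    congr 1
    exact (Finset.map_val e.toEmbedding _).symm.trans (by simp)

theorem isRigid_iff_nodup {n : ℕ} (P : IntervalOrderRel n) :
    IsRigid P ↔ (fishburnMultiset P).Nodup := by
  have : (fishburnMultiset P).Nodup ↔ Function.Injective (fishburnRep P) := by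
    rw [fishburnMultiset, Multiset.nodup_map_iff_inj_on Finset.univ.nodup]
    exact ⟨fun h a b hab => h a (Finset.mem_univ_val a) b (Finset.mem_univ_val b) hab,
      fun h a _ b _ hab => h hab⟩
  rw [this]
  constructor
  · intro h a b hab
    by_contra hne
    have hswap : ∀ x, fishburnRep P (Equiv.swap a b x) = fishburnRep P x := fun x => by
      rw [Equiv.swap_apply_def]
      split_ifs with h1 h2
      · rw [h1, hab]
      · rw [h2, hab]
      · rfl
    refine hne (Equiv.swap_eq_one_iff.1 (h (Equiv.swap a b) fun x y => ?_))
    rw [(isFishburnRep_fishburnRep P).1, (isFishburnRep_fishburnRep P).1, hswap, hswap]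
  · intro h e he
    ext x
    have := congrFun (fishburnRep_comp he) x
    rw [← h this]; rfl

theorem isFishburn_fishburnMultiset {n : ℕ} (P : IntervalOrderRel n) :
    ∃ k, IsFishburn k (fishburnMultiset P) := by
  obtain ⟨hr, k, h1, h2⟩ := isFishburnRep_fishburnRep P
  refine ⟨k, ?_, fun i => (h1 i).trans (by simp [fishburnMultiset]),
    fun i => (h2 i).trans (by simp [fishburnMultiset])⟩
  intro p hp
  obtain ⟨x, -, rfl⟩ := Multiset.mem_map.1 hp
  have := P.2.1.irrefl x
  rw [hr] at this
  omega

theorem exists_fishburnMultiset_eq {n k : ℕ} {s : Multiset (ℕ × ℕ)} (hs : s.card = n)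
    (h : IsFishburn k s) : ∃ P : IntervalOrderRel n, fishburnMultiset P = s := by
  obtain ⟨f, rfl⟩ : ∃ f : Fin n → ℕ × ℕ, Finset.univ.val.map f = s := by
    induction s using Quotient.inductionOn with
    | h l =>
      obtain rfl : l.length = n := hs
      exact ⟨l.get, by simp [Fin.univ_val_map]⟩
  obtain ⟨h0, h1, h2⟩ := h
  have h0' : ∀ x, (f x).1 ≤ (f x).2 := fun x => h0 _ (by simp)
  let P : IntervalOrderRel n := ⟨fun a b => (f a).2 < (f b).1,
    { irrefl := fun a => by have := h0' a; omega
      trans := fun a b c hab hbc => by have := h0' b; omega }, fun a b c d _ _ => by omega⟩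
  refine ⟨P, ?_⟩
  rw [fishburnMultiset, (isFishburnRep_fishburnRep P).eq (g := f)
    ⟨fun _ _ => Iff.rfl, k, fun i => (h1 i).trans (by simp), fun i => (h2 i).trans (by simp)⟩]

theorem card_quot_eq_card_fishburn {n : ℕ} {T : Type} (toP : T → IntervalOrderRel n)
    (q : Multiset (ℕ × ℕ) → Prop) (hq : ∀ P, q (fishburnMultiset P) ↔ ∃ t, toP t = P) :
    Nat.card (Quot fun P Q : T => IntervalOrderIso (toP P) (toP Q)) =
      Nat.card {s : Multiset (ℕ × ℕ) // (s.card = n ∧ q s) ∧ ∃ k, IsFishburn k s} := by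
  refine Nat.card_congr (Equiv.ofBijective (Quot.lift (fun t =>
    ⟨fishburnMultiset (toP t), ⟨by simp [fishburnMultiset], (hq _).2 ⟨t, rfl⟩⟩,
      isFishburn_fishburnMultiset _⟩) fun t t' h => ?_) ⟨?_, ?_⟩)
  · exact Subtype.ext (fishburnMultiset_eq_iff.2 h)
  · rintro ⟨t⟩ ⟨t'⟩ h
    exact Quot.sound (fishburnMultiset_eq_iff.1 (congrArg Subtype.val h))
  · rintro ⟨s, ⟨hs, hqs⟩, k, hk⟩
    obtain ⟨P, rfl⟩ := exists_fishburnMultiset_eq hs hk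
    obtain ⟨t, rfl⟩ := (hq P).1 hqs
    exact ⟨Quot.mk _ t, rfl⟩

theorem intervalOrderCount_eq (n : ℕ) : intervalOrderCount n =
    Nat.card {s : Multiset (ℕ × ℕ) // (s.card = n ∧ True) ∧ ∃ k, IsFishburn k s} :=
  card_quot_eq_card_fishburn id _ fun P => by simp

theorem rigidIntervalOrderCount_eq (n : ℕ) : rigidIntervalOrderCount n =
    Nat.card {s : Multiset (ℕ × ℕ) // (s.card = n ∧ s.Nodup) ∧ ∃ k, IsFishburn k s} :=
  card_quot_eq_card_fishburn Subtype.val _ fun P => by simp [← isRigid_iff_nodup]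

end FishburnRepresentation

section FishburnGeneratingFunction

open Finset PowerSeries

/-- The signed contribution of the `m`-element sets of rows to the generating function of Fishburn
matrices of magnitude `k`, where `w` is the generating function of a single cell. -/
noncomputable def fishburnTerm (w : ℚ⟦X⟧) : ℕ → ℕ → ℚ⟦X⟧
  | 0, 0 => 1
  | 0, _ + 1 => 0
  | _ + 1, 0 => 0
  | k + 1, m + 1 => (w ^ (m + 1) - 1) * (fishburnTerm w k m - fishburnTerm w k (m + 1))

theorem fishburnTerm_eq_zero (w : ℚ⟦X⟧) {k m : ℕ} (h : k < m) : fishburnTerm w k m = 0 := by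
  induction k generalizing m with
  | zero =>
    obtain ⟨m, rfl⟩ := Nat.exists_eq_succ_of_ne_zero h.ne'
    rfl
  | succ k ih =>
    obtain ⟨m, rfl⟩ := Nat.exists_eq_succ_of_ne_zero (Nat.ne_zero_of_lt h)
    rw [Nat.succ_eq_add_one, fishburnTerm, ih (by omega), ih (by omega), sub_zero, mul_zero]

theorem X_pow_dvd_fishburnTerm {w : ℚ⟦X⟧} (hw : X ∣ w - 1) (k m : ℕ) :
    X ^ k ∣ fishburnTerm w k m := by
  induction k generalizing m with
  | zero => simp
  | succ k ih =>
    cases m with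
    | zero => exact dvd_zero _
    | succ m =>
      rw [fishburnTerm, pow_succ']
      refine mul_dvd_mul (hw.trans ?_) (dvd_sub (ih _) (ih _))
      simpa using sub_dvd_pow_sub_pow w 1 (m + 1)

theorem fishburnTerm_eq_sum (w : ℚ⟦X⟧) (k m : ℕ) : fishburnTerm w k m =
    ∑ u ∈ powersetCard m (range k), (-1) ^ (k + #u) *
      ∏ j ∈ range k, (w ^ #{i ∈ u | i ≤ j} - 1) := by
  induction k generalizing m with
  | zero =>
    cases m with
    | zero => simp [fishburnTerm]
    | succ m => rw [range_zero, powersetCard_eq_empty.2 (by simp), sum_empty, fishburnTerm]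
  | succ k ih =>
    cases m with
    | zero => simp [fishburnTerm, prod_range_succ]
    | succ m =>
      have hcard : ∀ u ⊆ range (k + 1), #{i ∈ u | i ≤ k} = #u := fun u hu => by
        rw [filter_true_of_mem]
        intro i hi
        have := mem_range.1 (hu hi)
        omega
      have hins : ∀ u : Finset ℕ, ∀ j ∈ range k,
          #{i ∈ insert k u | i ≤ j} = #{i ∈ u | i ≤ j} := fun u j hj => by
        rw [filter_insert, if_neg]
        have := mem_range.1 hj
        omega
      have hk : k ∉ range k := notMem_range_self
      rw [fishburnTerm, range_add_one, powersetCard_succ_insert hk, sum_union, sum_image,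
        ih, ih, mul_sub, sub_eq_add_neg, add_comm, mul_sum, mul_sum, ← sum_neg_distrib]
      · congr 1
        · refine sum_congr rfl fun u hu => ?_
          obtain ⟨hu, hum⟩ := mem_powersetCard.1 hu
          rw [prod_insert hk, hcard u (hu.trans (range_subset_range.2 (by omega))), hum]
          simp only [Nat.succ_eq_add_one]
          ring
        · refine sum_congr rfl fun u hu => ?_
          obtain ⟨hu, hum⟩ := mem_powersetCard.1 hu
          have hku : k ∉ u := fun h => hk (hu h)
          rw [prod_insert hk, hcard (insert k u), card_insert_of_notMem hku, hum,
            prod_congr rfl fun j hj => congrArg (fun d => w ^ d - 1) (hins u j hj)]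
          · ring
          · rw [range_add_one]
            exact insert_subset_insert _ hu
      · intro u hu v hv huv
        have hku : k ∉ u := fun h => hk ((mem_powersetCard.1 hu).1 h)
        have hkv : k ∉ v := fun h => hk ((mem_powersetCard.1 hv).1 h)
        rw [← erase_insert hku, ← erase_insert hkv, huv]
      · rw [disjoint_left]
        intro u hu hu'
        obtain ⟨v, -, rfl⟩ := mem_image.1 hu'
        exact hk ((mem_powersetCard.1 hu).1 (mem_insert_self _ _))

theorem X_pow_dvd_sum_fishburnTerm_sub {w θ : ℚ⟦X⟧} (hw : X ∣ w - 1) (hθ : w * θ = 1) {K : ℕ}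
    (hK : 0 < K) (m : ℕ) :
    X ^ K ∣ ∑ k ∈ range K, fishburnTerm w k m - ∏ j ∈ range m, (1 - θ ^ (j + 1)) := by
  induction m with
  | zero =>
    obtain ⟨K, rfl⟩ := Nat.exists_eq_succ_of_ne_zero hK.ne'
    simp [sum_range_succ', fishburnTerm]
  | succ m ih =>
    have h1 : ∑ k ∈ range K, fishburnTerm w k (m + 1) + fishburnTerm w K (m + 1) =
        (w ^ (m + 1) - 1) * (∑ k ∈ range K, fishburnTerm w k m -
          ∑ k ∈ range K, fishburnTerm w k (m + 1)) := by
      rw [← sum_range_succ, sum_range_succ', ← sum_sub_distrib, mul_sum]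
      simp [fishburnTerm]
    have h2 : w ^ (m + 1) * θ ^ (m + 1) = 1 := by rw [← mul_pow, hθ, one_pow]
    have h3 : ∑ k ∈ range K, fishburnTerm w k (m + 1) =
        (1 - θ ^ (m + 1)) * ∑ k ∈ range K, fishburnTerm w k m -
          θ ^ (m + 1) * fishburnTerm w K (m + 1) := by
      linear_combination θ ^ (m + 1) * h1 + (∑ k ∈ range K, fishburnTerm w k m -
        ∑ k ∈ range K, fishburnTerm w k (m + 1)) * h2
    rw [h3, prod_range_succ, show ∀ a b c d : ℚ⟦X⟧, a * b - c - d * a = a * (b - d) - c by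
      intros; ring]
    exact dvd_sub (ih.mul_left _) ((X_pow_dvd_fishburnTerm hw _ _).mul_left _)

theorem X_pow_dvd_sum_powerset_sub_fishburnSum {w θ : ℚ⟦X⟧} (hw : X ∣ w - 1) (hθ : w * θ = 1)
    {K : ℕ} (hK : 0 < K) :
    X ^ K ∣ ∑ k ∈ range K, ∑ u ∈ (range k).powerset, (-1) ^ (k + #u) *
      ∏ j ∈ range k, (w ^ #{i ∈ u | i ≤ j} - 1) - fishburnSum K θ := by
  have : ∑ k ∈ range K, ∑ u ∈ (range k).powerset, (-1) ^ (k + #u) *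
      ∏ j ∈ range k, (w ^ #{i ∈ u | i ≤ j} - 1) =
      ∑ m ∈ range K, ∑ k ∈ range K, fishburnTerm w k m := by
    rw [sum_comm]
    refine sum_congr rfl fun k hk => ?_
    rw [sum_powerset, card_range]
    simp_rw [← fishburnTerm_eq_sum]
    refine sum_subset (range_subset_range.2 (mem_range.1 hk)) fun m _ hm => ?_
    exact fishburnTerm_eq_zero w (by simpa using hm)
  rw [this, fishburnSum, ← sum_sub_distrib]
  exact dvd_sum fun m _ => X_pow_dvd_sum_fishburnTerm_sub hw hθ hK m

theorem ite_forall_exists_eq_sum_powerset {R : Type*} [CommRing R] {α : Type*} (s : Multiset α)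
    (φ : α → ℕ) {k : ℕ} (h : ∀ p ∈ s, φ p < k) :
    (if ∀ i < k, ∃ p ∈ s, φ p = i then 1 else 0 : R) =
      ∑ u ∈ (range k).powerset, (-1) ^ (k + #u) * if ∀ p ∈ s, φ p ∈ u then 1 else 0 := by
  have h1 : (if ∀ i < k, ∃ p ∈ s, φ p = i then 1 else 0 : R) =
      ∏ i ∈ range k, (1 + -if ∀ p ∈ s, φ p ≠ i then 1 else 0) := by
    split_ifs with hs
    · refine (prod_eq_one fun i hi => ?_).symm
      obtain ⟨p, hp, hpi⟩ := hs i (mem_range.1 hi)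
      rw [if_neg fun h => h p hp hpi, neg_zero, add_zero]
    · push Not at hs
      obtain ⟨i, hi, hs⟩ := hs
      refine (prod_eq_zero (mem_range.2 hi) ?_).symm
      rw [if_pos hs, add_neg_cancel]
  rw [h1, prod_add]
  refine sum_congr rfl fun u hu => ?_
  have huk := mem_powerset.1 hu
  have hcard : k + #u = 2 * #u + #(range k \ u) := by
    have := card_sdiff_add_card_eq_card huk
    rw [card_range] at this
    omega
  rw [prod_const_one, one_mul, prod_neg, hcard, pow_add, pow_mul]
  simp only [neg_one_sq, one_pow, one_mul]
  congr 1
  rw [prod_ite_zero, prod_const_one]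
  refine if_congr ⟨fun H p hp => ?_, fun H i hi p hp hpi => ?_⟩ rfl rfl
  · by_contra hpu
    exact H _ (mem_sdiff.2 ⟨mem_range.2 (h p hp), hpu⟩) p hp rfl
  · exact (mem_sdiff.1 hi).2 (hpi ▸ H p hp)

theorem card_filter_triangle {k : ℕ} (u v : Finset ℕ) (hu : u ⊆ range k) (hv : v ⊆ range k) :
    #{p ∈ range k ×ˢ range k | p.1 ≤ p.2 ∧ p.1 ∈ u ∧ p.2 ∈ v} =
      ∑ j ∈ v, #{i ∈ u | i ≤ j} := by
  rw [card_eq_sum_card_fiberwise (f := Prod.snd) (t := v)]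
  · refine sum_congr rfl fun j hj => ?_
    refine card_bij (fun p _ => p.1) ?_ ?_ ?_
    · rintro ⟨a, b⟩ h
      simp only [mem_filter] at h ⊢
      exact ⟨h.1.2.2.1, h.2 ▸ h.1.2.1⟩
    · rintro ⟨a, b⟩ h ⟨c, d⟩ h' hac
      simp only [mem_filter] at h h'
      exact Prod.ext hac (h.2.trans h'.2.symm)
    · intro i hi
      obtain ⟨hi, hij⟩ := mem_filter.1 hi
      exact ⟨(i, j), by simp [hij, hi, hj, mem_range.1 (hu hi), mem_range.1 (hv hj)], rfl⟩
  · intro p hp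
    exact (mem_filter.1 (mem_coe.1 hp)).2.2.2

variable {n : ℕ} {w θ : ℚ⟦X⟧} {q : Multiset (ℕ × ℕ) → Prop}
  {M : Finset (ℕ × ℕ) → Finset (Multiset (ℕ × ℕ))}

theorem card_filter_isFishburn (hM : ∀ C s, s ∈ M C ↔ (s.card = n ∧ q s) ∧ ∀ p ∈ s, p ∈ C)
    (hw : ∀ C, (#(M C) : ℚ) = coeff n (w ^ #C)) (k : ℕ) :
    (#{s ∈ M {p ∈ range k ×ˢ range k | p.1 ≤ p.2} | IsFishburn k s} : ℚ) =
      coeff n (∑ u ∈ (range k).powerset, (-1) ^ (k + #u) *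
        ∏ j ∈ range k, (w ^ #{i ∈ u | i ≤ j} - 1)) := by
  have h1 : ∀ s ∈ M {p ∈ range k ×ˢ range k | p.1 ≤ p.2},
      (if IsFishburn k s then 1 else 0 : ℚ) = ∑ u ∈ (range k).powerset, ∑ v ∈ (range k).powerset,
        (-1) ^ (k + #u) * (-1) ^ (k + #v) *
          if ∀ p ∈ s, p.1 ∈ u ∧ p.2 ∈ v then 1 else 0 := by
    intro s hs
    have hp : ∀ p ∈ s, (p.1 < k ∧ p.2 < k) ∧ p.1 ≤ p.2 := fun p hp => by
      simpa using ((hM _ _).1 hs).2 p hp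
    have : IsFishburn k s ↔ (∀ i < k, ∃ p ∈ s, p.1 = i) ∧ ∀ i < k, ∃ p ∈ s, p.2 = i := by
      refine ⟨fun h => ⟨fun i => (h.2.1 i).1, fun i => (h.2.2 i).1⟩, fun h =>
        ⟨fun p h => (hp p h).2, fun i => ⟨h.1 i, ?_⟩, fun i => ⟨h.2 i, ?_⟩⟩⟩
      · rintro ⟨p, hps, rfl⟩
        exact (hp p hps).1.1
      · rintro ⟨p, hps, rfl⟩
        exact (hp p hps).1.2
    rw [if_congr this rfl rfl, ← mul_one (1 : ℚ), ← ite_zero_mul_ite_zero, mul_one,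
      ite_forall_exists_eq_sum_powerset s Prod.fst fun p h => (hp p h).1.1,
      ite_forall_exists_eq_sum_powerset s Prod.snd fun p h => (hp p h).1.2, sum_mul_sum]
    refine sum_congr rfl fun u _ => sum_congr rfl fun v _ => ?_
    rw [mul_mul_mul_comm, ite_zero_mul_ite_zero, mul_one]
    congr 1
    exact if_congr ⟨fun h p hps => ⟨h.1 p hps, h.2 p hps⟩,
      fun h => ⟨fun p hps => (h p hps).1, fun p hps => (h p hps).2⟩⟩ rfl rfl
  rw [card_filter, Nat.cast_sum]
  push_cast
  rw [sum_congr rfl h1, sum_comm, map_sum]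
  refine sum_congr rfl fun u hu => ?_
  rw [sum_comm]
  have h2 : ∏ j ∈ range k, (w ^ #{i ∈ u | i ≤ j} - 1) = ∑ v ∈ (range k).powerset,
      (-1) ^ (k + #v) * w ^ ∑ j ∈ v, #{i ∈ u | i ≤ j} := by
    simp_rw [sub_eq_add_neg]
    rw [prod_add]
    refine sum_congr rfl fun v hv => ?_
    have hcard : k + #v = 2 * #v + #(range k \ v) := by
      have := card_sdiff_add_card_eq_card (mem_powerset.1 hv)
      rw [card_range] at this
      omega
    rw [prod_pow_eq_pow_sum, prod_const, hcard, pow_add, pow_mul, neg_one_sq, one_pow, one_mul,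
      mul_comm]
  have hsign : ∀ (m : ℕ) (f : ℚ⟦X⟧), coeff n ((-1) ^ m * f) = (-1) ^ m * coeff n f :=
    fun m f => by rcases m.even_or_odd with h | h <;> simp [h.neg_one_pow]
  rw [h2, hsign, map_sum, mul_sum]
  refine sum_congr rfl fun v hv => ?_
  rw [← mul_sum, mul_assoc, hsign,
    ← card_filter_triangle u v (mem_powerset.1 hu) (mem_powerset.1 hv), ← hw, sum_boole]
  congr 4
  ext s
  simp only [mem_filter, hM]
  exact ⟨fun h => ⟨h.1.1, fun p hp => ⟨(h.1.2 p hp).1, (h.1.2 p hp).2, h.2 p hp⟩⟩,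
    fun h => ⟨⟨h.1, fun p hp => ⟨(h.2 p hp).1, (h.2 p hp).2.1⟩⟩, fun p hp => (h.2 p hp).2.2⟩⟩

theorem card_isFishburn_eq_coeff (hM : ∀ C s, s ∈ M C ↔ (s.card = n ∧ q s) ∧ ∀ p ∈ s, p ∈ C)
    (hw : ∀ C, (#(M C) : ℚ) = coeff n (w ^ #C)) (hX : X ∣ w - 1) (hθ : w * θ = 1) :
    (Nat.card {s : Multiset (ℕ × ℕ) // (s.card = n ∧ q s) ∧ ∃ k, IsFishburn k s} : ℚ) =
      coeff n (fishburnSum (n + 1) θ) := by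
  have hk : ∀ k s, IsFishburn k s → ∀ p ∈ s, p.1 < k ∧ p.2 < k :=
    fun k s h p hp => ⟨(h.2.1 _).2 ⟨p, hp, rfl⟩, (h.2.2 _).2 ⟨p, hp, rfl⟩⟩
  have hle : ∀ k s, IsFishburn k s → k ≤ s.card := fun k s h => by
    calc k = #(range k) := (card_range k).symm
      _ ≤ #(s.map Prod.fst).toFinset := card_le_card fun i hi => by
        simpa using (h.2.1 i).1 (mem_range.1 hi)
      _ ≤ s.card := by simpa using Multiset.toFinset_card_le (s.map Prod.fst)
  rw [Nat.subtype_card ((range (n + 1)).biUnion fun k =>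
      {s ∈ M {p ∈ range k ×ˢ range k | p.1 ≤ p.2} | IsFishburn k s}), card_biUnion]
  · push_cast
    rw [sum_congr rfl fun k _ => card_filter_isFishburn hM hw k, ← map_sum, ← sub_eq_zero,
      ← map_sub]
    exact X_pow_dvd_iff.1 (X_pow_dvd_sum_powerset_sub_fishburnSum hX hθ n.succ_pos) n n.lt_succ_self
  · intro k _ l _ hkl
    rw [Function.onFun, disjoint_left]
    intro s hs hs'
    refine hkl ?_
    have h1 := (mem_filter.1 hs).2.2.1
    have h2 := (mem_filter.1 hs').2.2.1
    exact le_antisymm (not_lt.1 fun h => lt_irrefl _ ((h2 l).2 ((h1 l).1 h)))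
      (not_lt.1 fun h => lt_irrefl _ ((h1 k).2 ((h2 k).1 h)))
  · intro s
    simp only [mem_biUnion, mem_filter, hM, mem_product, mem_range]
    constructor
    · rintro ⟨k, -, ⟨h, -⟩, hf⟩
      exact ⟨h, k, hf⟩
    · rintro ⟨h, k, hf⟩
      have := hle k s hf
      exact ⟨k, by omega, ⟨h, fun p hp => ⟨hk k s hf p hp, hf.1 p hp⟩⟩, hf⟩

theorem rigidIntervalOrderCount_eq_coeff (hθ : (1 + X) * θ = 1) (n : ℕ) :
    (rigidIntervalOrderCount n : ℚ) = coeff n (fishburnSum (n + 1) θ) := by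
  rw [rigidIntervalOrderCount_eq]
  refine card_isFishburn_eq_coeff (w := 1 + X)
    (M := fun C => (C.powersetCard n).map ⟨Finset.val, Finset.val_injective⟩) (fun C s => ?_)
    (fun C => ?_) (by simp) hθ
  · simp only [mem_map, mem_powersetCard, Function.Embedding.coeFn_mk]
    constructor
    · rintro ⟨t, ⟨h, rfl⟩, rfl⟩
      exact ⟨⟨rfl, t.nodup⟩, h⟩
    · rintro ⟨⟨h, hn⟩, hC⟩
      exact ⟨⟨s, hn⟩, ⟨hC, h⟩, rfl⟩
  · rw [card_map, card_powersetCard, add_comm, ← Polynomial.coe_X, ← Polynomial.coe_one,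
      ← Polynomial.coe_add, ← Polynomial.coe_pow, Polynomial.coeff_coe,
      Polynomial.coeff_X_add_one_pow]

theorem card_sym_eq_coeff {α : Type*} [DecidableEq α] (C : Finset α) (n : ℕ) :
    (#(C.sym n) : ℚ) = coeff n ((PowerSeries.mk fun _ => 1 : ℚ⟦X⟧) ^ #C) := by
  induction C using Finset.induction_on generalizing n with
  | empty => cases n <;> simp [coeff_one]
  | insert a s ha ih =>
    have := Fintype.card_congr (symInsertEquiv (n := n) ha)
    rw [Fintype.card_coe, Fintype.card_sigma] at this
    simp only [Fintype.card_coe] at this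
    rw [this, card_insert_of_notMem ha, pow_succ', coeff_mul,
      Nat.sum_antidiagonal_eq_sum_range_succ_mk, sum_range]
    push_cast
    refine sum_congr rfl fun i _ => ?_
    rw [ih, coeff_mk, one_mul]

theorem intervalOrderCount_eq_coeff (n : ℕ) :
    (intervalOrderCount n : ℚ) = coeff n (fishburnSum (n + 1) (1 - X : ℚ⟦X⟧)) := by
  rw [intervalOrderCount_eq]
  refine card_isFishburn_eq_coeff (w := PowerSeries.mk fun _ => 1)
    (M := fun C => (C.sym n).map ⟨Sym.toMultiset, Sym.coe_injective⟩) (fun C s => ?_)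
    (fun C => ?_) ?_ (mk_one_mul_one_sub_eq_one ℚ)
  · simp only [mem_map, mem_sym_iff, Function.Embedding.coeFn_mk]
    constructor
    · rintro ⟨t, h, rfl⟩
      exact ⟨⟨t.2, trivial⟩, fun p hp => h p hp⟩
    · rintro ⟨⟨h, -⟩, hC⟩
      exact ⟨⟨s, h⟩, fun p hp => hC p hp, rfl⟩
  · rw [card_map, card_sym_eq_coeff]
  · rw [X_dvd_iff]
    simp

end FishburnGeneratingFunction

section CoefficientTransform

open PowerSeries

theorem factorial_mul_coeff_pow {θ : ℚ⟦X⟧} {ε : ℚ} (h0 : constantCoeff θ = 1)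
    (h : (1 - C ε * X) * derivative ℚ θ = -θ) (a n : ℕ) :
    (n.factorial : ℚ) * coeff n (θ ^ a) = ∏ i ∈ Finset.range n, (-(a : ℚ) + ε * i) := by
  induction n with
  | zero => simp [h0]
  | succ n ih =>
    have h1 : (1 - C ε * X) * derivative ℚ (θ ^ a) = -(C (a : ℚ) * θ ^ a) := by
      cases a with
      | zero => simp
      | succ a =>
        rw [Derivation.leibniz_pow, Nat.add_sub_cancel, smul_eq_mul, nsmul_eq_mul, pow_succ]
        rw [map_natCast]
        push_cast
        linear_combination ((a : ℚ⟦X⟧) + 1) * θ ^ a * h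
    have h2 := congrArg (coeff n) h1
    rw [sub_mul, one_mul, map_sub, map_neg, coeff_C_mul, mul_assoc, coeff_C_mul,
      coeff_derivative] at h2
    have h3 : coeff n (X * derivative ℚ (θ ^ a)) = n * coeff n (θ ^ a) := by
      cases n with
      | zero => simp
      | succ n => rw [coeff_succ_X_mul, coeff_derivative]; push_cast; ring
    rw [h3] at h2
    rw [Finset.prod_range_succ, ← ih, Nat.factorial_succ]
    push_cast
    linear_combination (n.factorial : ℚ) * h2

theorem factorial_mul_coeff_expNeg_pow (a n : ℕ) :
    (n.factorial : ℚ) * coeff n (expNeg (1 : ℚ) ^ a) = (-(a : ℚ)) ^ n := by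
  rw [← expNeg_natCast_mul, coeff_expNeg, mul_one, Algebra.algebraMap_self_apply]
  field_simp

theorem factorial_mul_coeff_aeval {θ : ℚ⟦X⟧} {ε : ℚ} (h0 : constantCoeff θ = 1)
    (h : (1 - C ε * X) * derivative ℚ θ = -θ) (p : Polynomial ℚ) (n : ℕ) :
    (n.factorial : ℚ) * coeff n (Polynomial.aeval θ p) =
      ∑ j ∈ Finset.range (n + 1), ε ^ j * stirlingEsymm n j *
        ((n - j).factorial * coeff (n - j) (Polynomial.aeval (expNeg (1 : ℚ)) p)) := by
  induction p using Polynomial.induction_on' with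
  | add p q hp hq =>
    simp only [map_add, mul_add, Finset.sum_add_distrib, hp, hq]
  | monomial a c =>
    have hc : ∀ (k : ℕ) (φ : ℚ⟦X⟧), (k.factorial : ℚ) *
        coeff k (Polynomial.aeval φ (Polynomial.monomial a c)) =
          c * (k.factorial * coeff k (φ ^ a)) := fun k φ => by
      rw [Polynomial.aeval_monomial, PowerSeries.algebraMap_apply, coeff_C_mul,
        Algebra.algebraMap_self_apply]
      ring
    simp_rw [hc, factorial_mul_coeff_expNeg_pow]
    rw [factorial_mul_coeff_pow h0 h, prod_add_mul_eq_sum, Finset.mul_sum]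
    exact Finset.sum_congr rfl fun j _ => by ring

theorem aeval_fishburnSum {A : Type*} [CommRing A] [Algebra ℚ A] (x : A) (N : ℕ) :
    Polynomial.aeval x (fishburnSum N (Polynomial.X : Polynomial ℚ)) = fishburnSum N x := by
  simp [fishburnSum]

theorem coeff_fishburnSum_eq {θ : ℚ⟦X⟧} (h : X ∣ 1 - θ) {k N : ℕ} (hk : k < N) :
    coeff k (fishburnSum N θ) = coeff k (fishburnSum (k + 1) θ) := by
  rw [fishburnSum, fishburnSum, map_sum, map_sum]
  refine (Finset.sum_subset (Finset.range_subset_range.2 hk) fun m _ hm => ?_).symm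
  have hkm : k < m := by simpa using hm
  refine X_pow_dvd_iff.1 ?_ k hkm
  calc X ^ m = ∏ j ∈ Finset.range m, (X : ℚ⟦X⟧) := by simp
    _ ∣ _ := Finset.prod_dvd_prod_of_dvd _ _ fun j _ =>
      h.trans (by simpa using sub_dvd_pow_sub_pow 1 θ (j + 1))

/-- The Fishburn generating function `∑ ∏ (1 - q ^ j)` expanded in `t` for `q = exp (-t)`, as an
exponential generating function. -/
noncomputable def fishburnExp (k : ℕ) : ℚ :=
  k.factorial * coeff k (fishburnSum (k + 1) (expNeg (1 : ℚ)))

theorem factorial_mul_coeff_fishburnSum {θ : ℚ⟦X⟧} {ε : ℚ} (h0 : constantCoeff θ = 1)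
    (h : (1 - C ε * X) * derivative ℚ θ = -θ) (n : ℕ) :
    (n.factorial : ℚ) * coeff n (fishburnSum (n + 1) θ) =
      ∑ j ∈ Finset.range (n + 1), ε ^ j * stirlingEsymm n j * fishburnExp (n - j) := by
  rw [← aeval_fishburnSum, factorial_mul_coeff_aeval h0 h]
  refine Finset.sum_congr rfl fun j _ => ?_
  rw [aeval_fishburnSum, coeff_fishburnSum_eq (X_dvd_one_sub_expNeg 1) (by omega), fishburnExp]

theorem fishburnExp_eq_sum (n : ℕ) : (fishburnExp n : ℝ) =
    ∑ j ∈ Finset.range (n + 1), n.choose j * (1 / 24) ^ j * glaisher (n - j) := by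
  have h : fishburnExp n = ∑ j ∈ Finset.range (n + 1), n.choose j * (1 / 24) ^ j *
      ((n - j).factorial * (Polynomial.derivative (thetaPoly (n - j + 1))).eval 0) := by
    have h1 : fishburnSum (n + 2) (expNeg (1 : ℚ)) = expNeg (-(1 / 24) : ℚ) *
        (expNeg (1 / 24 : ℚ) * fishburnSum (n + 2) (expNeg 1)) := by
      rw [← mul_assoc, ← expNeg_add, neg_add_cancel, expNeg_zero, one_mul]
    rw [fishburnExp, ← coeff_fishburnSum_eq (N := n + 2) (X_dvd_one_sub_expNeg 1) (by omega), h1,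
      coeff_mul, Finset.Nat.sum_antidiagonal_eq_sum_range_succ_mk, Finset.mul_sum]
    refine Finset.sum_congr rfl fun j hj => ?_
    have hjn : j ≤ n := Nat.lt_succ_iff.1 (Finset.mem_range.1 hj)
    rw [derivative_thetaPoly_eval (N := n + 2) (by omega), coeff_expNeg, neg_neg,
      Algebra.algebraMap_self_apply, ← Nat.choose_mul_factorial_mul_factorial hjn]
    push_cast
    field_simp
  rw [h]
  push_cast
  rfl

end CoefficientTransform

section FishburnAsymptotics

open Filter Topology

theorem fishburnExp_pos (n : ℕ) : 0 < (fishburnExp n : ℝ) := by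
  rw [fishburnExp_eq_sum]
  refine Finset.sum_pos (fun j hj => ?_) ⟨0, by simp⟩
  have h1 := glaisher_pos (n - j)
  have h2 : 0 < n.choose j := Nat.choose_pos (Nat.lt_succ_iff.1 (Finset.mem_range.1 hj))
  positivity

theorem tendsto_fishburnExp :
    Tendsto (fun m : ℕ => ((m : ℝ) + 1) ^ 2 * fishburnExp m / fishburnExp (m + 1)) atTop
      (𝓝 (Real.pi ^ 2 / 6)) := by
  have h1 : Tendsto (fun n => (fishburnExp n : ℝ) / glaisher n) atTop (𝓝 1) := by
    simp_rw [fishburnExp_eq_sum]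
    exact tendsto_binomial_transform glaisher_pos tendsto_glaisher
      (by rw [abs_of_pos] <;> norm_num)
  have h2 := (h1.mul tendsto_glaisher).div (h1.comp (tendsto_add_atTop_nat 1)) one_ne_zero
  rw [one_mul, div_one] at h2
  refine h2.congr fun m => ?_
  have := (glaisher_pos m).ne'
  have := (glaisher_pos (m + 1)).ne'
  have := (fishburnExp_pos (m + 1)).ne'
  simp only [Function.comp, Pi.div_apply]
  field_simp

theorem tendsto_factorial_mul_div_fishburnExp {θ : ℕ → ℚ} {ε : ℚ} (hε : |ε| = 1)
    (h : ∀ n, (n.factorial : ℚ) * θ n =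
      ∑ j ∈ Finset.range (n + 1), ε ^ j * stirlingEsymm n j * fishburnExp (n - j)) :
    Tendsto (fun n => (n.factorial : ℝ) * θ n / fishburnExp n) atTop
      (𝓝 (Real.exp (ε * (Real.pi ^ 2 / 6) / 2))) := by
  refine (tendsto_stirling_transform fishburnExp_pos tendsto_fishburnExp (ε := ε)
    (by exact_mod_cast hε)).congr fun n => ?_
  have := congrArg (Rat.cast : ℚ → ℝ) (h n)
  push_cast at this
  rw [this]

end FishburnAsymptotics

/-- The proportion of unlabelled `n`-element interval orders that
are rigid tends to `e^{-π²/6}`. -/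
theorem rigid_proportion :
    Filter.Tendsto
      (fun n : ℕ => (rigidIntervalOrderCount n : ℝ) / (intervalOrderCount n : ℝ))
      Filter.atTop (nhds (Real.exp (-(Real.pi ^ 2 / 6)))) := by
  obtain ⟨θ, hθ⟩ : ∃ θ : PowerSeries ℚ, (1 + PowerSeries.X) * θ = 1 :=
    (PowerSeries.isUnit_iff_constantCoeff.2 (by simp)).exists_right_inv
  have hi := tendsto_factorial_mul_div_fishburnExp (θ := fun n => intervalOrderCount n) (ε := 1)
    (by simp) fun n => by
      rw [intervalOrderCount_eq_coeff]
      exact factorial_mul_coeff_fishburnSum (by simp) (by simp) n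
  have hr := tendsto_factorial_mul_div_fishburnExp (θ := fun n => rigidIntervalOrderCount n)
    (ε := -1) (by simp) fun n => by
      rw [rigidIntervalOrderCount_eq_coeff hθ]
      refine factorial_mul_coeff_fishburnSum ?_ ?_ n
      · simpa using congrArg PowerSeries.constantCoeff hθ
      · have := congrArg (PowerSeries.derivative ℚ) hθ
        rw [Derivation.leibniz] at this
        simp only [map_add, PowerSeries.derivative_one, PowerSeries.derivative_X, zero_add,
          smul_eq_mul, mul_one] at this
        rw [map_neg, map_one]
        linear_combination this
  have h := hr.div hi (Real.exp_pos _).ne'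
  rw [← Real.exp_sub] at h
  convert h using 2 with n
  · have := (fishburnExp_pos n).ne'
    have : (n.factorial : ℝ) ≠ 0 := by positivity
    simp only [Pi.div_apply]
    push_cast
    field_simp
  · congr 1
    push_cast
    ring
end

section
/- For all natural numbers n and k with 2k ≤ n, the number of unlabelled n-element interval orders in which the equivalence classes of the duplicated-holdings relation consist of exactly k classes of size two and n−2k classes of size one (i.e., with exactly k pairs of elements with duplicated holdings and no three elements pairwise having duplicated holdings) equals r_{n-k} · binomial(n-k, k), where r_m is the number of unlabelled rigid interval orders on m points. -/
open scoped Classical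

/-- `x` and `y` have the same strict down-set and the same strict up-set. -/
def SameHoldings {n : ℕ} (P : IntervalOrderRel n) (x y : Fin n) : Prop :=
  (∀ z, P.1 z x ↔ P.1 z y) ∧ (∀ z, P.1 x z ↔ P.1 y z)

/-- Having the same holdings, as a setoid. -/
def sameHoldingsSetoid {n : ℕ} (P : IntervalOrderRel n) : Setoid (Fin n) where
  r := SameHoldings P
  iseqv :=
    ⟨fun _ => ⟨fun _ => Iff.rfl, fun _ => Iff.rfl⟩,
      fun h => ⟨fun z => (h.1 z).symm, fun z => (h.2 z).symm⟩,
      fun h h' => ⟨fun z => (h.1 z).trans (h'.1 z), fun z => (h.2 z).trans (h'.2 z)⟩⟩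

/-- The interval order on `Fin n` induced from one on `Fin m` along a map. -/
def IntervalOrderRel.comap {m n : ℕ} (P : IntervalOrderRel m) (f : Fin n → Fin m) :
    IntervalOrderRel n :=
  ⟨fun a b => P.1 (f a) (f b),
    { irrefl := fun a => P.2.1.irrefl (f a)
      trans := fun a b c => P.2.1.trans (f a) (f b) (f c) },
    fun a b c d => P.2.2 (f a) (f b) (f c) (f d)⟩

/-- The fibers of `f` have size two over `S` and size one elsewhere. -/
def DoublesOver {m n : ℕ} (f : Fin n → Fin m) (S : Finset (Fin m)) : Prop :=
  ∀ v, Fintype.card {x // f x = v} = if v ∈ S then 2 else 1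

theorem intervalOrderIso_equivalence (n : ℕ) : Equivalence (IntervalOrderIso (n := n)) where
  refl _ := ⟨1, fun _ _ => Iff.rfl⟩
  symm := by
    rintro P Q ⟨e, he⟩
    exact ⟨e.symm, fun a b => by simp [he]⟩
  trans := by
    rintro P Q R ⟨e, he⟩ ⟨e', he'⟩
    exact ⟨e.trans e', fun a b => by simp [he, he']⟩

theorem quot_mk_eq_iff_intervalOrderIso {n : ℕ} {p : IntervalOrderRel n → Prop}
    (P Q : {P : IntervalOrderRel n // p P}) :
    Quot.mk (fun P Q : {P : IntervalOrderRel n // p P} => IntervalOrderIso P.1 Q.1) P =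
      Quot.mk _ Q ↔ IntervalOrderIso P.1 Q.1 := by
  rw [Quot.eq, Equivalence.eqvGen_iff]
  exact ⟨fun _ => (intervalOrderIso_equivalence n).refl _,
    fun h => (intervalOrderIso_equivalence n).symm h,
    fun h h' => (intervalOrderIso_equivalence n).trans h h'⟩

theorem dupHoldings_iff {n : ℕ} (P : IntervalOrderRel n) (x y : Fin n) :
    DupHoldings P x y ↔ x ≠ y ∧ SameHoldings P x y := Iff.rfl

theorem sameHoldings_apply_of_automorphism {n : ℕ} {P : IntervalOrderRel n}
    {e : Equiv.Perm (Fin n)} (he : ∀ a b, P.1 a b ↔ P.1 (e a) (e b)) (x : Fin n) :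
    SameHoldings P x (e x) := by
  have hD : (Finset.univ.filter fun z => P.1 z x).map e.toEmbedding =
      Finset.univ.filter fun z => P.1 z (e x) := by
    ext z
    simp only [Finset.mem_map_equiv, Finset.mem_filter, Finset.mem_univ, true_and]
    rw [he]; simp
  have hU : (Finset.univ.filter fun z => P.1 x z).map e.toEmbedding =
      Finset.univ.filter fun z => P.1 (e x) z := by
    ext z
    simp only [Finset.mem_map_equiv, Finset.mem_filter, Finset.mem_univ, true_and]
    rw [he]; simp
  have cD := congrArg Finset.card hD
  have cU := congrArg Finset.card hU
  rw [Finset.card_map] at cD cU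
  have key : ∀ s t : Finset (Fin n), s ⊆ t ∨ t ⊆ s → s.card = t.card → s = t := by
    rintro s t (h | h) hc
    · exact Finset.eq_of_subset_of_card_le h hc.ge
    · exact (Finset.eq_of_subset_of_card_le h hc.le).symm
  have eD := key _ _ (by
    by_contra! hcon
    obtain ⟨h1, h2⟩ := hcon
    simp only [Finset.not_subset, Finset.mem_filter, Finset.mem_univ, true_and] at h1 h2
    obtain ⟨a, ha, ha'⟩ := h1
    obtain ⟨c, hc, hc'⟩ := h2
    exact (P.2.2 _ _ _ _ ha hc).elim ha' hc') cD
  have eU := key _ _ (by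
    by_contra! hcon
    obtain ⟨h1, h2⟩ := hcon
    simp only [Finset.not_subset, Finset.mem_filter, Finset.mem_univ, true_and] at h1 h2
    obtain ⟨a, ha, ha'⟩ := h1
    obtain ⟨c, hc, hc'⟩ := h2
    exact (P.2.2 _ _ _ _ ha hc).elim hc' ha') cU
  exact ⟨fun z => by simpa using Finset.ext_iff.1 eD z,
    fun z => by simpa using Finset.ext_iff.1 eU z⟩

theorem IsRigid.of_sameHoldings {n : ℕ} {P : IntervalOrderRel n}
    (h : ∀ x y, SameHoldings P x y → x = y) : IsRigid P := fun _ he =>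
  Equiv.ext fun x => (h _ _ (sameHoldings_apply_of_automorphism he x)).symm

theorem IsRigid.eq_of_sameHoldings {n : ℕ} {P : IntervalOrderRel n} (hP : IsRigid P)
    {x y : Fin n} (h : SameHoldings P x y) : x = y := by
  have hl : ∀ a b, P.1 (Equiv.swap x y a) b ↔ P.1 a b := fun a b => by
    rw [Equiv.swap_apply_def]
    split_ifs with h1 h2
    · rw [h1, h.2]
    · rw [h2, h.2]
    · rfl
  have hr : ∀ a b, P.1 a (Equiv.swap x y b) ↔ P.1 a b := fun a b => by
    rw [Equiv.swap_apply_def]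
    split_ifs with h1 h2
    · rw [h1, h.1]
    · rw [h2, h.1]
    · rfl
  have hs := hP (Equiv.swap x y) fun a b => by rw [hl, hr]
  exact Equiv.swap_eq_one_iff.1 hs

theorem sameHoldings_comap_iff {m n : ℕ} {P : IntervalOrderRel m} (hP : IsRigid P)
    {f : Fin n → Fin m} (hf : Function.Surjective f) (x y : Fin n) :
    SameHoldings (P.comap f) x y ↔ f x = f y := by
  refine ⟨fun h => hP.eq_of_sameHoldings ⟨fun z => ?_, fun z => ?_⟩, fun h => ?_⟩
  · obtain ⟨z, rfl⟩ := hf z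
    exact h.1 z
  · obtain ⟨z, rfl⟩ := hf z
    exact h.2 z
  · simp [SameHoldings, IntervalOrderRel.comap, h]

theorem DoublesOver.surjective {m n : ℕ} {f : Fin n → Fin m} {S : Finset (Fin m)}
    (h : DoublesOver f S) : Function.Surjective f := fun v => by
  have : 0 < Fintype.card {x // f x = v} := by rw [h v]; split_ifs <;> norm_num
  obtain ⟨x⟩ := Fintype.card_pos_iff.1 this
  exact ⟨x.1, x.2⟩

theorem exists_doublesOver {m n : ℕ} (S : Finset (Fin m)) (h : m + S.card = n) :
    ∃ f : Fin n → Fin m, DoublesOver f S := by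
  have hc : Fintype.card (Fin n) =
      Fintype.card (Σ v : Fin m, Fin (if v ∈ S then 2 else 1)) := by
    have : ∀ v, (if v ∈ S then 2 else 1) = 1 + if v ∈ S then 1 else 0 := fun v => by
      split_ifs <;> rfl
    simp [this, Finset.sum_add_distrib, h]
  let e := Fintype.equivOfCardEq hc
  refine ⟨fun x => (e x).1, fun v => ?_⟩
  rw [Fintype.card_congr ((e.subtypeEquiv fun x => Iff.rfl).trans (Equiv.sigmaSubtype v)),
    Fintype.card_fin]

theorem exists_perm_comp_eq {m n : ℕ} {f g : Fin n → Fin m}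
    (h : ∀ v, Fintype.card {x // f x = v} = Fintype.card {x // g x = v}) :
    ∃ e : Equiv.Perm (Fin n), ∀ x, g (e x) = f x := by
  let E := fun v => Fintype.equivOfCardEq (h v)
  refine ⟨(Equiv.sigmaFiberEquiv f).symm.trans
    ((Equiv.sigmaCongrRight E).trans (Equiv.sigmaFiberEquiv g)), fun x => ?_⟩
  exact (E (f x) ⟨x, rfl⟩).2

theorem hasDupTriple_iff {m n : ℕ} {Q : IntervalOrderRel n} {f : Fin n → Fin m}
    (hf : ∀ x y, SameHoldings Q x y ↔ f x = f y) :
    HasDupTriple Q ↔ ∃ v, 2 < Fintype.card {x // f x = v} := by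
  simp only [Fintype.card_subtype, Finset.two_lt_card]
  simp only [HasDupTriple, dupHoldings_iff, hf, Finset.mem_filter, Finset.mem_univ, true_and]
  constructor
  · rintro ⟨x, y, z, hxy, hxz, hyz, h1, h2, -⟩
    exact ⟨f x, x, rfl, y, h1.2.symm, z, h2.2.symm, hxy, hxz, hyz⟩
  · rintro ⟨_, x, rfl, y, h1, z, h2, hxy, hxz, hyz⟩
    exact ⟨x, y, z, hxy, hxz, hyz, ⟨hxy, h1.symm⟩, ⟨hxz, h2.symm⟩, hyz, h1.trans h2.symm⟩

theorem dupPairCount_eq {m n : ℕ} {Q : IntervalOrderRel n} {f : Fin n → Fin m}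
    (hf : ∀ x y, SameHoldings Q x y ↔ f x = f y)
    (h2 : ∀ v, Fintype.card {x // f x = v} ≤ 2) :
    dupPairCount Q = (Finset.univ.filter fun v => Fintype.card {x // f x = v} = 2).card := by
  simp only [Fintype.card_subtype] at h2 ⊢
  rw [← Fintype.card_subtype, ← Nat.card_eq_fintype_card]
  symm
  refine Nat.card_congr (Equiv.ofBijective
    (fun v => ⟨Finset.univ.filter fun x => f x = v.1, ?_⟩) ⟨?_, ?_⟩)
  · obtain ⟨x, y, hxy, h⟩ := Finset.card_eq_two.1 v.2
    have hx : f x = v.1 := by simpa using (Finset.ext_iff.1 h x).2 (by simp)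
    have hy : f y = v.1 := by simpa using (Finset.ext_iff.1 h y).2 (by simp)
    exact ⟨x, y, ⟨hxy, (hf x y).2 (hx.trans hy.symm)⟩, h⟩
  · rintro ⟨v, hv⟩ ⟨w, hw⟩ hvw
    obtain ⟨x, hx⟩ := Finset.card_pos.1 (hv.symm ▸ two_pos)
    have hx' := (Finset.ext_iff.1 (congrArg Subtype.val hvw) x).1 hx
    simp only [Finset.mem_filter, Finset.mem_univ, true_and] at hx hx'
    exact Subtype.ext (hx.symm.trans hx')
  · rintro ⟨_, x, y, hxy, rfl⟩
    have hs : ({x, y} : Finset (Fin n)) ⊆ Finset.univ.filter fun z => f z = f x := by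
      have := (hf x y).1 hxy.2
      simp [Finset.insert_subset_iff, this]
    have hc := Finset.card_pair hxy.1
    have he := Finset.eq_of_subset_of_card_le hs (by rw [hc]; exact h2 _)
    exact ⟨⟨f x, by rw [← he, hc]⟩, Subtype.ext he.symm⟩

theorem DoublesOver.comap_spec {m n : ℕ} {P : IntervalOrderRel m} (hP : IsRigid P)
    {f : Fin n → Fin m} {S : Finset (Fin m)} (hf : DoublesOver f S) :
    dupPairCount (P.comap f) = S.card ∧ ¬HasDupTriple (P.comap f) := by
  have hs := sameHoldings_comap_iff hP hf.surjective
  have h2 : ∀ v, Fintype.card {x // f x = v} ≤ 2 := fun v => by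
    rw [hf v]; split_ifs <;> norm_num
  refine ⟨?_, ?_⟩
  · rw [dupPairCount_eq hs h2]
    congr 1
    ext v
    simp [hf v]
  · rw [hasDupTriple_iff hs]
    rintro ⟨v, hv⟩
    exact absurd (h2 v) hv.not_ge

theorem exists_perm_of_comap_iso {m n : ℕ} {P P' : IntervalOrderRel m} (hP : IsRigid P)
    (hP' : IsRigid P') {f f' : Fin n → Fin m} (hf : Function.Surjective f)
    (hf' : Function.Surjective f') {e : Equiv.Perm (Fin n)}
    (he : ∀ a b, (P.comap f).1 a b ↔ (P'.comap f').1 (e a) (e b)) :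
    ∃ σ : Equiv.Perm (Fin m), (∀ u v, P.1 u v ↔ P'.1 (σ u) (σ v)) ∧
      ∀ x, f' (e x) = σ (f x) := by
  have hff : ∀ x y, f x = f y ↔ f' (e x) = f' (e y) := fun x y => by
    rw [← sameHoldings_comap_iff hP hf, ← sameHoldings_comap_iff hP' hf']
    simp only [SameHoldings, he]
    refine and_congr ?_ ?_ <;>
    exact ⟨fun h z => by simpa using h (e.symm z), fun h z => h _⟩
  obtain ⟨g, hg⟩ := hf.hasRightInverse
  have hinj : Function.Injective fun v => f' (e (g v)) := fun u v huv => by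
    simpa [hg u, hg v] using (hff _ _).2 huv
  refine ⟨Equiv.ofBijective _ (Finite.injective_iff_bijective.1 hinj), fun u v => ?_, fun x => ?_⟩
  · have := he (g u) (g v)
    simpa [IntervalOrderRel.comap, hg u, hg v] using this
  · exact (hff _ _).1 (hg (f x)).symm

theorem exists_rigid_comap_eq {n : ℕ} (Q : IntervalOrderRel n) :
    ∃ (m : ℕ) (P : IntervalOrderRel m) (f : Fin n → Fin m), IsRigid P ∧
      Function.Surjective f ∧ P.comap f = Q := by
  let s := sameHoldingsSetoid Q
  let e : Quotient s ≃ Fin (Fintype.card (Quotient s)) := Fintype.equivFin _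
  let f : Fin n → Fin (Fintype.card (Quotient s)) := fun x => e (Quotient.mk s x)
  let g : Fin (Fintype.card (Quotient s)) → Fin n := fun v => (e.symm v).out
  have hfg : ∀ v, f (g v) = v := fun v => by simp [f, g]
  have hf : ∀ x y, f x = f y ↔ SameHoldings Q x y := fun x y => by
    simp only [f, e.apply_eq_iff_eq]
    exact Quotient.eq
  have hg : ∀ x y, Q.1 (g (f x)) (g (f y)) ↔ Q.1 x y := fun x y =>
    (((hf _ _).1 (hfg (f x))).2 _).trans (((hf _ _).1 (hfg (f y))).1 _)
  refine ⟨_, Q.comap g, f, IsRigid.of_sameHoldings fun u v h => ?_, fun v => ⟨g v, hfg v⟩,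
    Subtype.ext (funext₂ fun x y => propext (hg x y))⟩
  rw [← hfg u, ← hfg v, hf]
  refine ⟨fun z => ?_, fun z => ?_⟩
  · rw [← hg z, ← hg z, hfg, hfg]
    exact h.1 (f z)
  · rw [← hg _ z, ← hg _ z, hfg, hfg]
    exact h.2 (f z)

theorem exists_doublesOver_comap_eq {m k : ℕ} {Q : IntervalOrderRel (m + k)}
    (hk : dupPairCount Q = k) (hQ : ¬HasDupTriple Q) :
    ∃ (P : IntervalOrderRel m) (f : Fin (m + k) → Fin m) (S : Finset (Fin m)),
      IsRigid P ∧ DoublesOver f S ∧ S.card = k ∧ P.comap f = Q := by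
  obtain ⟨m', P, f, hP, hf, rfl⟩ := exists_rigid_comap_eq Q
  have hs := sameHoldings_comap_iff hP hf
  have h2 : ∀ v, Fintype.card {x // f x = v} ≤ 2 := fun v => by
    by_contra! h
    exact hQ ((hasDupTriple_iff hs).2 ⟨v, h⟩)
  rw [dupPairCount_eq hs h2] at hk
  set S := Finset.univ.filter fun v => Fintype.card {x // f x = v} = 2 with hS
  have hd : DoublesOver f S := fun v => by
    have h0 : 0 < Fintype.card {x // f x = v} :=
      Fintype.card_pos_iff.2 ⟨⟨_, (hf v).choose_spec⟩⟩
    have := h2 v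
    simp only [hS, Finset.mem_filter, Finset.mem_univ, true_and]
    split_ifs <;> omega
  have hm : m' + S.card = m + k := by
    have h1 : ∀ v, (if v ∈ S then 2 else 1) = 1 + if v ∈ S then 1 else 0 := fun v => by
      split_ifs <;> rfl
    have := Fintype.card_congr (Equiv.sigmaFiberEquiv f)
    rw [Fintype.card_sigma, Finset.sum_congr rfl fun v _ => (hd v).trans (h1 v)] at this
    simpa [Finset.sum_add_distrib] using this
  obtain rfl : m' = m := by omega
  exact ⟨P, f, S, hP, hd, hk, rfl⟩

/-- For `2k ≤ n`, the number of unlabelled `n`-element interval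
orders whose duplicated-holdings classes are exactly `k` classes of size two and
`n - 2k` of size one (i.e. having exactly `k` unordered pairs of elements with
duplicated holdings and no triple of elements pairwise with duplicated holdings)
equals `r_{n-k} · (n-k choose k)`. -/
theorem unlabelled_with_k_dup_pairs (n k : ℕ) (h : 2 * k ≤ n) :
    Nat.card (Quot fun (P Q : {P : IntervalOrderRel n //
        dupPairCount P = k ∧ ¬HasDupTriple P}) => IntervalOrderIso P.1 Q.1) =
      rigidIntervalOrderCount (n - k) * (n - k).choose k := by
  obtain ⟨m, rfl⟩ : ∃ m, n = m + k := ⟨n - k, by omega⟩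
  rw [Nat.add_sub_cancel]
  have hchoose : m.choose k = Nat.card {S : Finset (Fin m) // S.card = k} := by
    rw [Nat.card_eq_fintype_card, Fintype.card_finset_len, Fintype.card_fin]
  rw [hchoose, rigidIntervalOrderCount, ← Nat.card_prod]
  have hex : ∀ S : {S : Finset (Fin m) // S.card = k},
      ∃ f : Fin (m + k) → Fin m, DoublesOver f S.1 := fun S =>
    exists_doublesOver S.1 (by rw [S.2])
  choose f hf using hex
  symm
  refine Nat.card_congr (Equiv.ofBijective (fun p => Quot.mk _
    ⟨p.1.out.1.comap (f p.2), by simpa only [p.2.2] using (hf p.2).comap_spec p.1.out.2⟩)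
    ⟨?_, ?_⟩)
  · rintro ⟨q, S⟩ ⟨q', S'⟩ hqq
    obtain ⟨e, he⟩ := (quot_mk_eq_iff_intervalOrderIso _ _).1 hqq
    obtain ⟨σ, hσ, hσf⟩ := exists_perm_of_comap_iso q.out.2 q'.out.2 (hf S).surjective
      (hf S').surjective he
    obtain rfl : q = q' := by
      rw [← q.out_eq, ← q'.out_eq]
      exact (quot_mk_eq_iff_intervalOrderIso _ _).2 ⟨σ, hσ⟩
    obtain rfl := q.out.2 σ hσ
    have hSS : S.1 = S'.1 := by
      ext v
      have hc := Fintype.card_congr (e.subtypeEquiv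
        (p := fun x => f S x = v) (q := fun x => f S' x = v) fun x => by simp [hσf])
      rw [hf S v, hf S' v] at hc
      split_ifs at hc <;> simp_all
    rw [Subtype.ext hSS]
  · rintro ⟨Q, hk, hQ⟩
    obtain ⟨P, g, S, hP, hg, hS, rfl⟩ := exists_doublesOver_comap_eq hk hQ
    let q : Quot fun (P Q : {P : IntervalOrderRel m // IsRigid P}) => IntervalOrderIso P.1 Q.1 :=
      Quot.mk _ ⟨P, hP⟩
    obtain ⟨σ, hσ⟩ := (quot_mk_eq_iff_intervalOrderIso q.out ⟨P, hP⟩).1 q.out_eq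
    let T : {S : Finset (Fin m) // S.card = k} :=
      ⟨S.map σ.symm.toEmbedding, by rw [Finset.card_map, hS]⟩
    obtain ⟨e, he⟩ := exists_perm_comp_eq (f := fun x => σ (f T x)) (g := g) fun v => by
      have := hf T (σ.symm v)
      rw [hg v]
      simp only [T, Finset.mem_map_equiv, Equiv.symm_symm, Equiv.apply_symm_apply] at this
      simpa only [← this] using Fintype.card_congr
        (Equiv.subtypeEquivRight fun x => (Equiv.eq_symm_apply σ).symm)
    refine ⟨(q, T), (quot_mk_eq_iff_intervalOrderIso _ _).2 ⟨e, fun a b => ?_⟩⟩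
    simp only [IntervalOrderRel.comap, he]
    exact hσ _ _
end
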